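/- arXiv:math/0610699 — 9 statements merged into one kernel-verified Lean document; each statement's English description precedes it below -/
import Mathlib

section
/- Let d be a positive square-free integer and K = ℚ(√−d). The quaternion algebra ℍ(K) = (−1,−1/K) is a division ring if and only if d ≡ 7 (mod 8). -/
open Quaternion

/-- Integers congruent to `7` modulo `8` are not sums of three rational squares (integral form). -/
theorem eq_zero_of_mul_sq_eq_sum_three_sq {d : ℤ} (hd : d % 8 = 7) :
    ∀ (k : ℕ) (n x y z : ℤ), n.natAbs ≤ k → d * n ^ 2 = x ^ 2 + y ^ 2 + z ^ 2 → n = 0 := by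
  have sq_mod (a : ℤ) : a % 2 = 0 ∧ a ^ 2 % 4 = 0 ∧ (a ^ 2 % 8 = 0 ∨ a ^ 2 % 8 = 4) ∨
      a % 2 = 1 ∧ a ^ 2 % 4 = 1 ∧ a ^ 2 % 8 = 1 := by
    have h8 : a % 8 = 0 ∨ a % 8 = 1 ∨ a % 8 = 2 ∨ a % 8 = 3 ∨ a % 8 = 4 ∨ a % 8 = 5 ∨
      a % 8 = 6 ∨ a % 8 = 7 := by omega
    have h := Int.emod_emod_of_dvd (a ^ 2) (show (4 : ℤ) ∣ 8 by norm_num)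
    have h2 := Int.emod_emod_of_dvd a (show (2 : ℤ) ∣ 8 by norm_num)
    rcases h8 with h8 | h8 | h8 | h8 | h8 | h8 | h8 | h8 <;>
      have hs := Int.mul_emod a a 8 <;> rw [h8, ← pow_two] at hs <;> norm_num at hs <;> omega
  intro k
  induction k with
  | zero => intro n x y z hn _; omega
  | succ k ih =>
    intro n x y z hn h
    have hmod : (7 * (n ^ 2 % 8)) % 8 = (x ^ 2 + y ^ 2 + z ^ 2) % 8 := by
      rw [← h, Int.mul_emod d, hd]
    have hall : n % 2 = 0 ∧ x % 2 = 0 ∧ y % 2 = 0 ∧ z % 2 = 0 := by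
      rcases sq_mod n with hn | hn <;> rcases sq_mod x with hx | hx <;>
        rcases sq_mod y with hy | hy <;> rcases sq_mod z with hz | hz <;> omega
    obtain ⟨hn2, hx, hy, hz⟩ := hall
    obtain ⟨n, rfl⟩ := Int.dvd_of_emod_eq_zero hn2
    obtain ⟨x, rfl⟩ := Int.dvd_of_emod_eq_zero hx
    obtain ⟨y, rfl⟩ := Int.dvd_of_emod_eq_zero hy
    obtain ⟨z, rfl⟩ := Int.dvd_of_emod_eq_zero hz
    by_contra hne
    have := ih n x y z (by omega) (by linarith)
    omega

/-- Integers congruent to `7` modulo `8` are not sums of three rational squares. -/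
theorem rat_eq_zero_of_mul_sq_eq_sum_three_sq {d : ℤ} (hd : d % 8 = 7) {n x y z : ℚ}
    (h : d * n ^ 2 = x ^ 2 + y ^ 2 + z ^ 2) : n = 0 := by
  have hn := n.num_div_den
  have hx := x.num_div_den
  have hy := y.num_div_den
  have hz := z.num_div_den
  have dn : (n.den : ℚ) ≠ 0 := by simp
  have dx : (x.den : ℚ) ≠ 0 := by simp
  have dy : (y.den : ℚ) ≠ 0 := by simp
  have dz : (z.den : ℚ) ≠ 0 := by simp
  rw [← hn, ← hx, ← hy, ← hz] at h
  field_simp at h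
  have key : d * (n.num * x.den * y.den * z.den) ^ 2 = (x.num * n.den * y.den * z.den) ^ 2
      + (y.num * n.den * x.den * z.den) ^ 2 + (z.num * n.den * x.den * y.den) ^ 2 := by
    have : (d * (n.num * x.den * y.den * z.den) ^ 2 : ℚ) = (x.num * n.den * y.den * z.den) ^ 2
      + (y.num * n.den * x.den * z.den) ^ 2 + (z.num * n.den * x.den * y.den) ^ 2 := by
      linear_combination h
    exact_mod_cast this
  have := eq_zero_of_mul_sq_eq_sum_three_sq hd _ _ _ _ _ le_rfl key
  simpa using this

/-- A case of Legendre's theorem on ternary quadratic forms, proved by the pigeonhole principle. -/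
theorem exists_sq_add_mul_sq_eq_mul_sq {d m : ℕ} (hd : 0 < d) (hm : 0 < m)
    (hdm : Nat.Coprime d m) (hsq : ¬ IsSquare (m : ℤ)) (hdvd : (d : ℤ) ∣ m + 1)
    {b : ℤ} (hb : (m : ℤ) ∣ b ^ 2 - d) :
    ∃ z w t : ℤ, t ≠ 0 ∧ z ^ 2 + m * w ^ 2 = d * t ^ 2 := by
  classical
  have : NeZero d := ⟨hd.ne'⟩
  have : NeZero m := ⟨hm.ne'⟩
  let s : Finset (ℕ × ℕ × ℕ) := Finset.range (Nat.sqrt (m * d) + 1) ×ˢ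
    Finset.range (Nat.sqrt d + 1) ×ˢ Finset.range (Nat.sqrt m + 1)
  let f : ℕ × ℕ × ℕ → ZMod d × ZMod m := fun p =>
    ((p.1 : ZMod d) - p.2.1, (p.1 : ZMod m) - (b : ZMod m) * p.2.2)
  have hcard : (Finset.univ : Finset (ZMod d × ZMod m)).card < s.card := by
    simp only [s, Finset.card_product, Finset.card_range, Finset.card_univ, Fintype.card_prod,
      ZMod.card]
    have h1 := Nat.lt_succ_sqrt' (m * d)
    have h2 := Nat.lt_succ_sqrt' d
    have h3 := Nat.lt_succ_sqrt' m
    simp only [Nat.succ_eq_add_one] at h1 h2 h3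
    refine lt_of_pow_lt_pow_left₀ 2 (Nat.zero_le _) ?_
    calc (d * m) ^ 2 = (m * d) * (d * m) := by ring
      _ < (Nat.sqrt (m * d) + 1) ^ 2 * ((Nat.sqrt d + 1) ^ 2 * (Nat.sqrt m + 1) ^ 2) := by
        gcongr
      _ = _ := by ring
  obtain ⟨⟨z₁, w₁, t₁⟩, h₁, ⟨z₂, w₂, t₂⟩, h₂, hne, hf⟩ :=
    Finset.exists_ne_map_eq_of_card_lt_of_maps_to hcard (f := f) (fun _ _ => Finset.mem_univ _)
  simp only [s, Finset.mem_product, Finset.mem_range] at h₁ h₂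
  simp only [f, Prod.mk.injEq] at hf
  obtain ⟨z, hz⟩ : ∃ z : ℤ, z = z₁ - z₂ := ⟨_, rfl⟩
  obtain ⟨w, hw⟩ : ∃ w : ℤ, w = w₁ - w₂ := ⟨_, rfl⟩
  obtain ⟨t, ht⟩ : ∃ t : ℤ, t = t₁ - t₂ := ⟨_, rfl⟩
  have sq_le {x y n : ℕ} {v : ℤ} (hv : v = x - y) (hx : x < n.sqrt + 1) (hy : y < n.sqrt + 1) :
      v ^ 2 ≤ n := by
    have h : v ^ 2 ≤ (n.sqrt : ℤ) ^ 2 := sq_le_sq' (by omega) (by omega)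
    exact h.trans (by exact_mod_cast Nat.sqrt_le' n)
  have hz2 : z ^ 2 ≤ m * d := by exact_mod_cast sq_le hz h₁.1 h₂.1
  have hw2 : w ^ 2 ≤ d := sq_le hw h₁.2.1 h₂.2.1
  have ht2 : t ^ 2 ≤ m := sq_le ht h₁.2.2 h₂.2.2
  have hne0 : ¬ (z = 0 ∧ w = 0 ∧ t = 0) := by
    rintro ⟨rfl, rfl, rfl⟩
    exact hne (by simp only [Prod.mk.injEq]; omega)
  have hd1 : (d : ℤ) ∣ z - w := by
    rw [← ZMod.intCast_zmod_eq_zero_iff_dvd, hz, hw]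
    push_cast
    linear_combination hf.1
  have hm1 : (m : ℤ) ∣ z - b * t := by
    rw [← ZMod.intCast_zmod_eq_zero_iff_dvd, hz, ht]
    push_cast
    linear_combination hf.2
  have hdV : (d : ℤ) ∣ z ^ 2 + m * w ^ 2 - d * t ^ 2 := by
    have : z ^ 2 + m * w ^ 2 - d * t ^ 2
      = (z - w) * (z + w) + (m + 1) * w ^ 2 - d * t ^ 2 := by ring
    rw [this]
    exact dvd_sub (dvd_add (hd1.mul_right _) (hdvd.mul_right _)) (dvd_mul_right _ _)
  have hmV : (m : ℤ) ∣ z ^ 2 + m * w ^ 2 - d * t ^ 2 := by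
    have : z ^ 2 + m * w ^ 2 - d * t ^ 2
      = (z - b * t) * (z + b * t) + (b ^ 2 - d) * t ^ 2 + m * w ^ 2 := by ring
    rw [this]
    exact dvd_add (dvd_add (hm1.mul_right _) (hb.mul_right _)) (dvd_mul_right _ _)
  obtain ⟨c, hc⟩ : (m * d : ℤ) ∣ z ^ 2 + m * w ^ 2 - d * t ^ 2 :=
    (Nat.isCoprime_iff_coprime.mpr hdm.symm).mul_dvd hmV hdV
  have hd' : (0 : ℤ) < d := by exact_mod_cast hd
  have hm' : (0 : ℤ) < m := by exact_mod_cast hm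
  have hmd : (0 : ℤ) < m * d := mul_pos hm' hd'
  have ht3 : t ^ 2 < m := lt_of_le_of_ne ht2 fun h => hsq ⟨t, by rw [← h, sq]⟩
  have hc1 : -1 < c := by
    have : (m * d : ℤ) * (-1) < m * d * c := by
      rw [← hc]; nlinarith [mul_lt_mul_of_pos_left ht3 hd', sq_nonneg z, sq_nonneg w]
    exact lt_of_mul_lt_mul_left this hmd.le
  by_cases hdw : w ^ 2 = d
  · exact ⟨w, 0, 1, one_ne_zero, by rw [hdw]; ring⟩
  have hw3 : w ^ 2 < d := lt_of_le_of_ne hw2 hdw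
  have hc2 : c < 2 := by
    have : (m * d : ℤ) * c < m * d * 2 := by
      rw [← hc]; nlinarith [mul_lt_mul_of_pos_left hw3 hm', sq_nonneg t]
    exact lt_of_mul_lt_mul_left this hmd.le
  obtain rfl | rfl : c = 0 ∨ c = 1 := by omega
  · refine ⟨z, w, t, ?_, by linarith⟩
    rintro rfl
    refine hne0 ⟨?_, ?_, rfl⟩
    · have : z ^ 2 = 0 := by nlinarith [sq_nonneg z, sq_nonneg w, mul_nonneg hm'.le (sq_nonneg w)]
      simpa using this
    · have : m * w ^ 2 = 0 := by
        nlinarith [sq_nonneg z, sq_nonneg w, mul_nonneg hm'.le (sq_nonneg w)]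
      simpa [hm.ne'] using this
  · refine ⟨z * t - m * w, z + w * t, t ^ 2 + m, by positivity, ?_⟩
    linear_combination (t ^ 2 + m) * hc

/-- If the Jacobi symbol of `a` at a prime is `1`, then `a` is a square modulo that prime. -/
theorem Nat.Prime.dvd_sq_sub_of_jacobiSym_eq_one {q : ℕ} (hq : q.Prime) {a : ℤ}
    (h : jacobiSym a q = 1) : ∃ b : ℤ, (q : ℤ) ∣ b ^ 2 - a := by
  have := Fact.mk hq
  rw [← jacobiSym.legendreSym.to_jacobiSym] at h
  have ha : (a : ZMod q) ≠ 0 := by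
    intro h0
    rw [(legendreSym.eq_zero_iff q a).mpr h0] at h
    exact zero_ne_one h
  obtain ⟨x, hx⟩ := (legendreSym.eq_one_iff q ha).mp h
  refine ⟨x.val, ?_⟩
  rw [← ZMod.intCast_zmod_eq_zero_iff_dvd]
  push_cast
  rw [ZMod.natCast_zmod_val, hx]
  ring

/-- Dirichlet's theorem on primes in arithmetic progressions, as a congruence in `ℕ`. -/
theorem Nat.exists_prime_gt_and_mod_eq {n a : ℕ} (hn : 0 < n) (h : Nat.Coprime a n) (k : ℕ) :
    ∃ q, k < q ∧ q.Prime ∧ q ≡ a [MOD n] := by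
  have : NeZero n := ⟨hn.ne'⟩
  obtain ⟨q, hq, hp, he⟩ :=
    Nat.forall_exists_prime_gt_and_eq_mod ((ZMod.isUnit_iff_coprime a n).mpr h) k
  exact ⟨q, hq, hp, (ZMod.natCast_eq_natCast_iff _ _ _).mp he⟩

theorem Nat.Prime.coprime_of_lt {d q : ℕ} (hq : q.Prime) (hd : 0 < d) (h : d < q) :
    Nat.Coprime d q :=
  Nat.Coprime.symm ((Nat.Prime.coprime_iff_not_dvd hq).mpr (Nat.not_dvd_of_pos_of_lt hd h))

/-- The weak (rational) form of the three-squares theorem. -/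
theorem exists_sum_three_sq_eq_mul_sq_of_mod {d : ℕ} (hd4 : d % 4 ≠ 0) (hd7 : d % 8 ≠ 7) :
    ∃ x y z t : ℤ, t ≠ 0 ∧ x ^ 2 + y ^ 2 + z ^ 2 = d * t ^ 2 := by
  have hd : 0 < d := by omega
  suffices ∃ m : ℕ, 0 < m ∧ Nat.Coprime d m ∧ ¬ IsSquare (m : ℤ) ∧ (d : ℤ) ∣ m + 1 ∧
      (∃ b : ℤ, (m : ℤ) ∣ b ^ 2 - d) ∧ ∃ x y : ℕ, x ^ 2 + y ^ 2 = m by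
    obtain ⟨m, hm, hdm, hsq, hdvd, ⟨b, hb⟩, x, y, hxy⟩ := this
    obtain ⟨z, w, t, ht, h⟩ := exists_sq_add_mul_sq_eq_mul_sq hd hm hdm hsq hdvd hb
    refine ⟨z, x * w, y * w, t, ht, ?_⟩
    rw [← h, ← hxy]
    push_cast
    ring
  have two_sq {q : ℕ} (hq : q.Prime) (h4 : q % 4 = 1) : ∃ x y : ℕ, x ^ 2 + y ^ 2 = q := by
    have := Fact.mk hq
    exact Nat.Prime.sq_add_sq (by omega)
  have prime_case {q : ℕ} (hq : q.Prime) (h4 : q % 4 = 1) (hlt : d < q)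
      (hdvd : (d : ℤ) ∣ q + 1) (hJ : jacobiSym d q = 1) : ∃ m : ℕ, 0 < m ∧ Nat.Coprime d m ∧
      ¬ IsSquare (m : ℤ) ∧ (d : ℤ) ∣ m + 1 ∧
      (∃ b : ℤ, (m : ℤ) ∣ b ^ 2 - d) ∧ ∃ x y : ℕ, x ^ 2 + y ^ 2 = m :=
    ⟨q, hq.pos, hq.coprime_of_lt hd hlt, (Nat.prime_iff_prime_int.mp hq).irreducible.not_isSquare,
      hdvd, hq.dvd_sq_sub_of_jacobiSym_eq_one hJ, two_sq hq h4⟩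
  have mod_of_dvd {q a n : ℕ} (h : q ≡ a [MOD 4 * d]) (hn : n ∣ 4 * d) : q % n = a % n :=
    h.of_dvd hn
  obtain h1 | h3 | h2 : d % 4 = 1 ∨ d % 8 = 3 ∨ d % 4 = 2 := by omega
  · have hodd : Odd d := Nat.odd_iff.mpr (by omega)
    have hco : Nat.Coprime (2 * d - 1) (4 * d) := by
      rw [← Nat.isCoprime_iff_coprime]
      refine ⟨2 * d - 1, 1 - d, ?_⟩
      rw [Nat.cast_sub (by omega)]
      push_cast
      ring
    obtain ⟨q, hlt, hq, hmod⟩ := Nat.exists_prime_gt_and_mod_eq (by omega) hco d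
    have hq4 : q % 4 = 1 := by have := mod_of_dvd hmod (dvd_mul_right 4 d); omega
    have hdvd : (d : ℤ) ∣ q + 1 := by
      obtain ⟨c, hc⟩ := Nat.modEq_iff_dvd.mp (hmod.of_dvd (dvd_mul_left d 4)).symm
      rw [Nat.cast_sub (by omega)] at hc
      push_cast at hc
      exact ⟨c + 2, by linear_combination hc⟩
    refine prime_case hq hq4 hlt hdvd ?_
    rw [← jacobiSym.quadratic_reciprocity_one_mod_four hq4 hodd,
      jacobiSym.mod_left' (a₂ := -1)
        (Int.modEq_iff_dvd.mpr (by rw [← neg_add', add_comm 1]; exact hdvd.neg_right)),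
      jacobiSym.at_neg_one hodd, ZMod.χ₄_nat_one_mod_four h1]
  · obtain ⟨k, rfl⟩ : ∃ k, d = 8 * k + 3 := ⟨d / 8, by omega⟩
    have hodd : Odd (8 * k + 3) := Nat.odd_iff.mpr (by omega)
    have hco : Nat.Coprime (4 * k + 1) (4 * (8 * k + 3)) := by
      rw [← Nat.isCoprime_iff_coprime]
      refine ⟨1 + 8 * k, -k, ?_⟩
      push_cast
      ring
    obtain ⟨q, hlt, hq, hmod⟩ := Nat.exists_prime_gt_and_mod_eq (by omega) hco (8 * k + 3)
    have hq4 : q % 4 = 1 := by have := mod_of_dvd hmod (dvd_mul_right 4 _); omega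
    have hdvd : ((8 * k + 3 : ℕ) : ℤ) ∣ (2 * q : ℕ) + 1 := by
      obtain ⟨c, hc⟩ := Nat.modEq_iff_dvd.mp (hmod.of_dvd (dvd_mul_left _ 4)).symm
      push_cast at hc ⊢
      exact ⟨2 * c + 1, by linear_combination 2 * hc⟩
    have hJ : jacobiSym (8 * k + 3 : ℕ) q = 1 := by
      have h4 : jacobiSym (4 * q) (8 * k + 3) = jacobiSym (-2) (8 * k + 3) :=
        jacobiSym.mod_left' (Int.modEq_iff_dvd.mpr (by
          obtain ⟨c, hc⟩ := hdvd
          push_cast at hc ⊢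
          exact ⟨-2 * c, by linear_combination -2 * hc⟩))
      rw [jacobiSym.mul_left, jacobiSym.at_four hodd, one_mul, jacobiSym.at_neg_two hodd,
        ZMod.χ₈'_nat_eq_if_mod_eight, if_neg (by omega), if_pos (by omega)] at h4
      rw [← jacobiSym.quadratic_reciprocity_one_mod_four hq4 hodd, h4]
    obtain ⟨b, hb⟩ : ∃ b : ℤ, (q : ℤ) ∣ b ^ 2 - (8 * k + 3 : ℕ) ∧ b % 2 = 1 := by
      obtain ⟨b, hb⟩ := hq.dvd_sq_sub_of_jacobiSym_eq_one hJ
      obtain h | h := Int.emod_two_eq_zero_or_one b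
      · obtain ⟨c, hc⟩ := hb
        exact ⟨b + q, ⟨c + 2 * b + q, by linear_combination hc⟩, by omega⟩
      · exact ⟨b, hb, h⟩
    refine ⟨2 * q, by have := hq.pos; omega, ?_, ?_, hdvd, ⟨b, ?_⟩, ?_⟩
    · exact (Nat.coprime_two_right.mpr hodd).mul_right (hq.coprime_of_lt hd hlt)
    · rintro ⟨r, hr⟩
      have h8 : (2 * q : ℤ) % 4 = 2 := by omega
      push_cast at hr
      rw [hr, Int.mul_emod] at h8
      have : r % 4 = 0 ∨ r % 4 = 1 ∨ r % 4 = 2 ∨ r % 4 = 3 := by omega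
      rcases this with h | h | h | h <;> simp [h] at h8
    · push_cast
      refine IsCoprime.mul_dvd ?_ ?_ (by exact_mod_cast hb.1)
      · exact_mod_cast Nat.isCoprime_iff_coprime.mpr
          (Nat.coprime_two_left.mpr (Nat.odd_iff.mpr (by omega)))
      · obtain ⟨c, hc⟩ : ∃ c, b = 2 * c + 1 := ⟨b / 2, by omega⟩
        exact ⟨2 * c ^ 2 + 2 * c - 4 * k - 1, by rw [hc]; ring⟩
    · obtain ⟨x, y, h⟩ := two_sq hq hq4
      obtain ⟨u, v, huv⟩ := Nat.sq_add_sq_mul (a := 2) (x := 1) (y := 1) rfl h.symm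
      exact ⟨u, v, huv.symm⟩
  · obtain ⟨f, rfl⟩ : ∃ f, d = 2 * (2 * f + 1) := ⟨d / 4, by omega⟩
    have hodd : Odd (2 * f + 1) := Nat.odd_iff.mpr (by omega)
    have hco : Nat.Coprime (4 * f + 1) (4 * (2 * (2 * f + 1))) := by
      rw [← Nat.isCoprime_iff_coprime]
      refine ⟨4 * f + 1, -f, ?_⟩
      push_cast
      ring
    obtain ⟨q, hlt, hq, hmod⟩ := Nat.exists_prime_gt_and_mod_eq (by omega) hco (2 * (2 * f + 1))
    have hq8 : q % 8 = (4 * f + 1) % 8 := mod_of_dvd hmod ⟨2 * f + 1, by ring⟩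
    have hq4 : q % 4 = 1 := by omega
    have hdvd : ((2 * (2 * f + 1) : ℕ) : ℤ) ∣ q + 1 := by
      obtain ⟨c, hc⟩ := Nat.modEq_iff_dvd.mp (hmod.of_dvd (dvd_mul_left _ 4)).symm
      push_cast at hc ⊢
      exact ⟨c + 1, by linear_combination hc⟩
    refine prime_case hq hq4 hlt hdvd ?_
    have hdvd' : ((2 * f + 1 : ℕ) : ℤ) ∣ q + 1 :=
      (Int.natCast_dvd_natCast.mpr (dvd_mul_left _ 2)).trans hdvd
    rw [Nat.cast_mul, jacobiSym.mul_left,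
      ← jacobiSym.quadratic_reciprocity_one_mod_four hq4 hodd,
      jacobiSym.mod_left' (a₁ := q) (a₂ := -1)
        (Int.modEq_iff_dvd.mpr (by rw [← neg_add', add_comm 1]; exact hdvd'.neg_right)),
      jacobiSym.at_neg_one hodd, Nat.cast_ofNat,
      jacobiSym.at_two (Nat.odd_iff.mpr (by omega)),
      ZMod.χ₈_nat_eq_if_mod_eight, ZMod.χ₄_nat_eq_if_mod_four]
    split_ifs <;> first | rfl | omega

/-- Let `d` be a positive square-free integer and `K = ℚ(√−d)`
(a field containing an element `rd` with `rd² = −d` and generated over `ℚ` by `rd`).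
The quaternion algebra `ℍ(K) = (−1,−1 / K)` is a division ring iff `d ≡ 7 (mod 8)`. -/
theorem quaternion_algebra_division_ring_iff
    (d : ℤ) (hd : 0 < d) (hsf : Squarefree d)
    (K : Type) [Field K] [NumberField K]
    (rd : K) (hrd : rd ^ 2 = -(d : K))
    (hgen : Algebra.adjoin ℚ {rd} = ⊤) :
    (∀ x : ℍ[K], x ≠ 0 → IsUnit x) ↔ d % 8 = 7 := by
  have hd0 : (d : K) ≠ 0 := by exact_mod_cast hd.ne'
  have hrd0 : rd ≠ 0 := by
    rintro rfl
    exact hd0 (by simpa using hrd)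
  constructor
  · intro hunit
    by_contra h7
    lift d to ℕ using hd.le
    have h4 : d % 4 ≠ 0 := by
      intro h
      have : (2 * 2 : ℤ) ∣ d := by omega
      exact absurd (hsf 2 this) (by decide)
    obtain ⟨x, y, z, t, ht, h⟩ := exists_sum_three_sq_eq_mul_sq_of_mod h4 (by omega)
    have hK : (x ^ 2 + y ^ 2 + z ^ 2 : K) = d * t ^ 2 := by exact_mod_cast h
    let a : ℍ[K] := ⟨rd * t, x, y, z⟩
    have hre : a.re ≠ 0 := mul_ne_zero hrd0 (by exact_mod_cast ht)
    have ha : a ≠ 0 := fun h0 => hre (by rw [h0]; rfl)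
    have hnorm : normSq a = 0 := by
      rw [normSq_def']
      simp only [a]
      push_cast at hrd
      linear_combination hK + t ^ 2 * hrd
    have hmul : a * star a = 0 := by rw [self_mul_star, hnorm]; simp
    have := (hunit a ha).mul_right_eq_zero.mp hmul
    exact ha (star_eq_zero.mp this)
  · intro h7
    have hrat (u : K) : ∃ p q : ℚ, u = p + q * rd := by
      have hu : u ∈ Algebra.adjoin ℚ {rd} := by rw [hgen]; trivial
      induction hu using Algebra.adjoin_induction with
      | mem x hx => exact ⟨0, 1, by simp [Set.mem_singleton_iff.mp hx]⟩
      | algebraMap r => exact ⟨r, 0, by simp⟩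
      | add x y _ _ hx hy =>
        obtain ⟨p, q, rfl⟩ := hx
        obtain ⟨p', q', rfl⟩ := hy
        exact ⟨p + p', q + q', by push_cast; ring⟩
      | mul x y _ _ hx hy =>
        obtain ⟨p, q, rfl⟩ := hx
        obtain ⟨p', q', rfl⟩ := hy
        exact ⟨p * p' - d * q * q', p * q' + q * p', by
          push_cast; linear_combination q * q' * hrd⟩
    have hindep (p q : ℚ) (h : (p + q * rd : K) = 0) : p = 0 ∧ q = 0 := by
      have h2 : (p ^ 2 + d * q ^ 2 : K) = 0 := by
        linear_combination (p - q * rd) * h + q ^ 2 * hrd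
      have h2 : p ^ 2 + d * q ^ 2 = 0 := by exact_mod_cast h2
      have hdq : (0 : ℚ) < d := by exact_mod_cast hd
      have hp : p ^ 2 = 0 := by nlinarith [sq_nonneg p, mul_nonneg hdq.le (sq_nonneg q)]
      have hq : d * q ^ 2 = 0 := by nlinarith [sq_nonneg p, mul_nonneg hdq.le (sq_nonneg q)]
      exact ⟨by simpa using hp, by simpa [hd.ne'] using hq⟩
    intro x hx
    have hnorm : normSq x ≠ 0 := by
      intro h0
      rw [normSq_def'] at h0
      obtain ⟨p₀, q₀, h₀⟩ := hrat x.re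
      obtain ⟨p₁, q₁, h₁⟩ := hrat x.imI
      obtain ⟨p₂, q₂, h₂⟩ := hrat x.imJ
      obtain ⟨p₃, q₃, h₃⟩ := hrat x.imK
      rw [h₀, h₁, h₂, h₃] at h0
      obtain ⟨hp, hpq⟩ := hindep
        (p₀ ^ 2 + p₁ ^ 2 + p₂ ^ 2 + p₃ ^ 2 - d * (q₀ ^ 2 + q₁ ^ 2 + q₂ ^ 2 + q₃ ^ 2))
        (2 * (p₀ * q₀ + p₁ * q₁ + p₂ * q₂ + p₃ * q₃)) (by
          push_cast
          linear_combination h0 - (q₀ ^ 2 + q₁ ^ 2 + q₂ ^ 2 + q₃ ^ 2 : K) * hrd)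
      have hpq : p₀ * q₀ + p₁ * q₁ + p₂ * q₂ + p₃ * q₃ = 0 := by linarith
      have hq : q₀ ^ 2 + q₁ ^ 2 + q₂ ^ 2 + q₃ ^ 2 = 0 :=
        rat_eq_zero_of_mul_sq_eq_sum_three_sq h7
          (x := p₀ * q₁ - p₁ * q₀ + p₂ * q₃ - p₃ * q₂)
          (y := p₀ * q₂ - p₂ * q₀ + p₃ * q₁ - p₁ * q₃)
          (z := p₀ * q₃ - p₃ * q₀ + p₁ * q₂ - p₂ * q₁) (by
            linear_combination (p₀ * q₀ + p₁ * q₁ + p₂ * q₂ + p₃ * q₃) * hpq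
              - (q₀ ^ 2 + q₁ ^ 2 + q₂ ^ 2 + q₃ ^ 2) * hp)
      have hp : p₀ ^ 2 + p₁ ^ 2 + p₂ ^ 2 + p₃ ^ 2 = 0 := by
        linear_combination hp + d * hq
      have sum_zero {a b c e : ℚ} (h : a ^ 2 + b ^ 2 + c ^ 2 + e ^ 2 = 0) :
          a = 0 ∧ b = 0 ∧ c = 0 ∧ e = 0 := by
        refine ⟨?_, ?_, ?_, ?_⟩ <;> rw [← sq_eq_zero_iff] <;>
          nlinarith [sq_nonneg a, sq_nonneg b, sq_nonneg c, sq_nonneg e]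
      obtain ⟨rfl, rfl, rfl, rfl⟩ := sum_zero hp
      obtain ⟨rfl, rfl, rfl, rfl⟩ := sum_zero hq
      simp only [Rat.cast_zero, zero_mul, add_zero] at h₀ h₁ h₂ h₃
      exact hx (QuaternionAlgebra.ext h₀ h₁ h₂ h₃)
    have hcomm : x * star x = star x * x := by rw [self_mul_star, star_mul_self]
    have hu : IsUnit (x * star x) := by
      rw [self_mul_star]
      exact (hnorm.isUnit).map (algebraMap K ℍ[K])
    exact ((show Commute x (star x) from hcomm).isUnit_mul_iff.mp hu).1
end

section
/- Let d be a positive square-free integer and K = ℚ(√−d). Then −1 is NOT a sum of three squares of elements of K if and only if d ≡ 7 (mod 8). (Equivalently, the stufe s(K) equals 4 exactly when d ≡ 7 (mod 8).) -/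
/-- Thue's lemma for two simultaneous congruences in three unknowns. -/
lemma exists_small_solution_of_congruences (d a : ℕ) (hd : 0 < d) (ha : 0 < a) (r s : ℤ) :
    ∃ w t z : ℤ, (w ≠ 0 ∨ t ≠ 0 ∨ z ≠ 0) ∧ (d : ℤ) ∣ w - s * t ∧ (a : ℤ) ∣ w - r * z ∧
      w ^ 2 ≤ d * a ∧ t ^ 2 ≤ d ∧ z ^ 2 ≤ a := by
  have : NeZero d := ⟨hd.ne'⟩
  have : NeZero a := ⟨ha.ne'⟩
  let box := Finset.range ((d * a).sqrt + 1) ×ˢ Finset.range (d.sqrt + 1) ×ˢ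
    Finset.range (a.sqrt + 1)
  let f : ℕ × ℕ × ℕ → ZMod d × ZMod a := fun x =>
    (((x.1 : ℤ) - s * (x.2.1 : ℤ) : ℤ), ((x.1 : ℤ) - r * (x.2.2 : ℤ) : ℤ))
  have hcard : (Finset.univ : Finset (ZMod d × ZMod a)).card < box.card := by
    simp only [box, Finset.card_product, Finset.card_range, Finset.card_univ, Fintype.card_prod,
      ZMod.card]
    refine lt_of_pow_lt_pow_left₀ 2 (Nat.zero_le _) ?_
    calc (d * a) ^ 2 = (d * a) * (d * a) := sq _
      _ < ((d * a).sqrt + 1) ^ 2 * ((d.sqrt + 1) ^ 2 * (a.sqrt + 1) ^ 2) :=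
        Nat.mul_lt_mul'' (Nat.lt_succ_sqrt' _)
          (Nat.mul_lt_mul'' (Nat.lt_succ_sqrt' _) (Nat.lt_succ_sqrt' _))
      _ = _ := by ring
  obtain ⟨x, hx, y, hy, hxy, hf⟩ := Finset.exists_ne_map_eq_of_card_lt_of_maps_to hcard
    (f := f) (fun _ _ => Finset.mem_coe.2 (Finset.mem_univ _))
  obtain ⟨x₁, x₂, x₃⟩ := x
  obtain ⟨y₁, y₂, y₃⟩ := y
  simp only [box, Finset.mem_product, Finset.mem_range, Nat.lt_succ_iff] at hx hy
  simp only [f, Prod.mk.injEq, ZMod.intCast_eq_intCast_iff_dvd_sub] at hf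
  have key : ∀ n u v : ℕ, u ≤ n.sqrt → v ≤ n.sqrt → ((v : ℤ) - u) ^ 2 ≤ n := by
    intro n u v hu hv
    have h₁ : ((n.sqrt : ℤ)) ^ 2 ≤ n := by exact_mod_cast Nat.sqrt_le' n
    refine le_trans (sq_le_sq' ?_ ?_) h₁ <;> omega
  refine ⟨y₁ - x₁, y₂ - x₂, y₃ - x₃, ?_, ?_, ?_, ?_, key _ _ _ hx.2.1 hy.2.1,
    key _ _ _ hx.2.2 hy.2.2⟩
  · by_contra! h
    apply hxy
    simp only [Prod.mk.injEq]
    omega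
  · convert hf.1 using 1; ring
  · convert hf.2 using 1; ring
  · exact_mod_cast key _ _ _ hx.1 hy.1

/-- A special case of Legendre's theorem on ternary quadratic forms. -/
lemma exists_mul_sq_eq_sq_add_mul_sq (d a : ℕ) (hd : Squarefree d) (ha : Squarefree a)
    (ha1 : a ≠ 1) (hda : d.Coprime a) (r s : ℤ) (hr : (a : ℤ) ∣ r ^ 2 - d)
    (hs : (d : ℤ) ∣ s ^ 2 + a) :
    ∃ w t z : ℤ, z ≠ 0 ∧ d * z ^ 2 = w ^ 2 + a * t ^ 2 := by
  have hd0 : 0 < d := Nat.pos_of_ne_zero hd.ne_zero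
  have ha0 : 0 < a := Nat.pos_of_ne_zero ha.ne_zero
  obtain ⟨w, t, z, hne, h₁, h₂, hw, ht, hz⟩ :=
    exists_small_solution_of_congruences d a hd0 ha0 r s
  have not_sq : ∀ n : ℕ, Squarefree n → n ≠ 1 → ∀ x : ℤ, x ^ 2 ≠ n := by
    intro n hn hn1 x hx
    have : x.natAbs * x.natAbs = n := by
      zify; rw [← sq, sq_abs, hx]
    have h1 := Nat.isUnit_iff.1 (hn x.natAbs this.dvd)
    rw [h1] at this
    exact hn1 this.symm
  have hw' : w ^ 2 < d * a := by
    refine lt_of_le_of_ne hw ?_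
    have := not_sq (d * a) ((Nat.squarefree_mul hda).2 ⟨hd, ha⟩)
      (fun h => ha1 (Nat.eq_one_of_mul_eq_one_left h)) w
    exact_mod_cast this
  have hz' : z ^ 2 < a := lt_of_le_of_ne hz (not_sq a ha ha1 z)
  have hd0' : (0 : ℤ) < d := by exact_mod_cast hd0
  have ha0' : (0 : ℤ) < a := by exact_mod_cast ha0
  have hdvd : (d * a : ℤ) ∣ w ^ 2 + a * t ^ 2 - d * z ^ 2 := by
    refine IsCoprime.mul_dvd (Nat.isCoprime_iff_coprime.2 hda) ?_ ?_
    · have : w ^ 2 + a * t ^ 2 - d * z ^ 2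
          = (w - s * t) * (w + s * t) + (s ^ 2 + a) * t ^ 2 - d * z ^ 2 := by ring
      rw [this]
      exact dvd_sub (dvd_add (h₁.mul_right _) (hs.mul_right _)) (dvd_mul_right _ _)
    · have : w ^ 2 + a * t ^ 2 - d * z ^ 2
          = (w - r * z) * (w + r * z) + (r ^ 2 - d) * z ^ 2 + a * t ^ 2 := by ring
      rw [this]
      exact dvd_add (dvd_add (h₂.mul_right _) (hr.mul_right _)) (dvd_mul_right _ _)
  obtain ⟨k, hk⟩ := hdvd
  have hda0 : (0 : ℤ) < d * a := mul_pos hd0' ha0'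
  have hk1 : -1 < k := by
    refine lt_of_mul_lt_mul_left ?_ hda0.le
    nlinarith [sq_nonneg w, mul_nonneg ha0'.le (sq_nonneg t), mul_lt_mul_of_pos_left hz' hd0']
  have hk2 : k < 2 := by
    refine lt_of_mul_lt_mul_left ?_ hda0.le
    nlinarith [mul_nonneg hd0'.le (sq_nonneg z), mul_le_mul_of_nonneg_left ht ha0'.le]
  obtain rfl | rfl : k = 0 ∨ k = 1 := by omega
  · refine ⟨w, t, z, ?_, by linarith⟩
    rintro rfl
    have hw0 : w ^ 2 = 0 := by nlinarith [sq_nonneg w, mul_nonneg ha0'.le (sq_nonneg t)]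
    have ht0 : a * t ^ 2 = 0 := by nlinarith [sq_nonneg w, mul_nonneg ha0'.le (sq_nonneg t)]
    simp_all
  · refine ⟨w * z + a * t, w - t * z, z ^ 2 + a, by positivity, ?_⟩
    linear_combination (-(z ^ 2 + a) : ℤ) * hk

section

open NumberTheorySymbols ZMod

lemma exists_prime_gt_of_dvd_sub_of_mod_eight (e : ℕ) (u : ℤ) (v : ℕ) (he : Odd e)
    (hu : IsCoprime u e) (hv : Odd v) (n : ℕ) :
    ∃ q > n, q.Prime ∧ (e : ℤ) ∣ q - u ∧ q ≡ v [MOD 8] := by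
  have coprime_eight : ∀ m : ℕ, Odd m → IsCoprime (m : ℤ) (8 : ℕ) := fun m hm => by
    rw [Nat.isCoprime_iff_coprime]
    simpa using Nat.Coprime.pow_right 3 (Nat.coprime_two_right.2 hm)
  obtain ⟨x, y, hxy⟩ := coprime_eight e he
  have h₁ : IsCoprime (u + e * (x * (v - u))) ((e * 8 : ℕ) : ℤ) := by
    rw [Nat.cast_mul]
    refine IsCoprime.mul_right (hu.add_mul_left_left _) ?_
    rw [show u + e * (x * (v - u)) = v + (8 : ℕ) * (y * (u - v)) by
      linear_combination (v - u) * hxy]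
    exact (coprime_eight v hv).add_mul_left_left _
  obtain ⟨q, hq, hqp, hqc⟩ := Nat.forall_exists_prime_gt_and_zmodEq n
    (mul_ne_zero he.pos.ne' (by norm_num)) h₁
  obtain ⟨k, hk⟩ := hqc.symm.dvd
  push_cast at hk hxy
  refine ⟨q, hq, hqp, ⟨8 * k + x * (v - u), by linear_combination hk⟩,
    (Nat.modEq_iff_dvd.2 ⟨e * k + y * (u - v), ?_⟩).symm⟩
  push_cast
  linear_combination hk + (v - u) * hxy

lemma exists_dvd_sq_sub_of_jacobiSym_eq_one {q : ℕ} (hq : q.Prime) {d : ℤ} (h : J(d | q) = 1) :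
    ∃ r : ℤ, (q : ℤ) ∣ r ^ 2 - d := by
  have : Fact q.Prime := ⟨hq⟩
  obtain ⟨y, hy⟩ := ZMod.isSquare_of_jacobiSym_eq_one h
  obtain ⟨r, rfl⟩ := ZMod.intCast_surjective y
  refine ⟨r, ?_⟩
  rw [← ZMod.intCast_zmod_eq_zero_iff_dvd]
  push_cast
  rw [hy]; ring

/-- For a positive square-free `d ≢ 7 (mod 8)` some multiple `d * z ^ 2` with `z ≠ 0` is a sum of
three squares. -/
lemma exists_mul_sq_eq_sum_three_sq (d : ℕ) (hd : Squarefree d) (hd7 : d % 8 ≠ 7) :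
    ∃ z x₁ x₂ x₃ : ℤ, z ≠ 0 ∧ d * z ^ 2 = x₁ ^ 2 + x₂ ^ 2 + x₃ ^ 2 := by
  have hd0 : 0 < d := Nat.pos_of_ne_zero hd.ne_zero
  suffices h : ∃ a : ℕ, Squarefree a ∧ a ≠ 1 ∧ d.Coprime a ∧ (∃ m n : ℕ, m ^ 2 + n ^ 2 = a) ∧
      (∃ r : ℤ, (a : ℤ) ∣ r ^ 2 - d) ∧ ∃ s : ℤ, (d : ℤ) ∣ s ^ 2 + a by
    obtain ⟨a, ha, ha1, hda, ⟨m, n, hmn⟩, ⟨r, hr⟩, s, hs⟩ := h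
    obtain ⟨w, t, z, hz, h⟩ := exists_mul_sq_eq_sq_add_mul_sq d a hd ha ha1 hda r s hr hs
    refine ⟨z, w, m * t, n * t, hz, ?_⟩
    rw [h, ← hmn]; push_cast; ring
  have coprime_of_lt : ∀ q : ℕ, q.Prime → d < q → d.Coprime q := fun q hq hlt =>
    ((Nat.Prime.coprime_iff_not_dvd hq).2 (Nat.not_dvd_of_pos_of_lt hd0 hlt)).symm
  have sum_sq : ∀ q : ℕ, q.Prime → q % 4 = 1 → ∃ m n : ℕ, m ^ 2 + n ^ 2 = q := fun q hq h => by
    have : Fact q.Prime := ⟨hq⟩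
    exact Nat.Prime.sq_add_sq (by omega)
  rcases Nat.even_or_odd d with heven | hodd
  · obtain ⟨e, rfl⟩ := heven.two_dvd
    have he : Odd e := by
      rw [← Nat.not_even_iff_odd]
      intro h
      obtain ⟨k, rfl⟩ := h.two_dvd
      have := hd 2 ⟨k, by ring⟩
      simp at this
    obtain ⟨v, hv4, hv⟩ : ∃ v : ℕ, v % 4 = 1 ∧ χ₈ (v : ZMod 8) = χ₄ (e : ZMod 4) := by
      have : e % 4 = 1 ∨ e % 4 = 3 := by have := Nat.odd_iff.1 he; omega
      rcases this with h | h
      · exact ⟨1, rfl, by rw [ZMod.χ₄_nat_one_mod_four h]; decide⟩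
      · exact ⟨5, rfl, by rw [ZMod.χ₄_nat_three_mod_four h]; decide⟩
    obtain ⟨q, hq, hqp, hqe, hq8⟩ := exists_prime_gt_of_dvd_sub_of_mod_eight e (-1) v he
      isCoprime_one_left.neg_left (Nat.odd_iff.2 (by omega)) (2 * e)
    have hq4 : q % 4 = 1 := by
      have : q % 8 = v % 8 := hq8
      omega
    have hqodd : Odd q := Nat.odd_iff.2 (by omega)
    refine ⟨q, hqp.prime.squarefree, hqp.ne_one, coprime_of_lt q hqp hq, sum_sq q hqp hq4,
      exists_dvd_sq_sub_of_jacobiSym_eq_one hqp ?_, 1, ?_⟩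
    · have h8 : χ₈ (q : ZMod 8) = χ₄ (e : ZMod 4) := by
        rw [(ZMod.natCast_eq_natCast_iff _ _ _).2 hq8, hv]
      push_cast
      rw [jacobiSym.mul_left, jacobiSym.at_two hqodd,
        ← jacobiSym.quadratic_reciprocity_one_mod_four hq4 he,
        jacobiSym.mod_left' (Int.emod_eq_emod_iff_emod_sub_eq_zero.2 (Int.emod_eq_zero_of_dvd hqe)),
        jacobiSym.at_neg_one he, h8]
      have : e % 4 = 1 ∨ e % 4 = 3 := by have := Nat.odd_iff.1 he; omega
      rcases this with h | h
      · rw [ZMod.χ₄_nat_one_mod_four h]; rfl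
      · rw [ZMod.χ₄_nat_three_mod_four h]; rfl
    · have h2 : (2 : ℤ) ∣ 1 ^ 2 + q := by omega
      push_cast
      refine IsCoprime.mul_dvd ?_ h2 ?_
      · exact_mod_cast Nat.isCoprime_iff_coprime.2 (Nat.coprime_two_left.2 he)
      · rwa [show (1 : ℤ) + q = q - -1 by ring]
  have hd8 : d % 4 = 1 ∨ d % 8 = 3 := by have := Nat.odd_iff.1 hodd; omega
  rcases hd8 with hd4 | hd8
  · obtain ⟨q, hq, hqp, hqd, hq8⟩ := exists_prime_gt_of_dvd_sub_of_mod_eight d (-1) 1 hodd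
      isCoprime_one_left.neg_left odd_one d
    have hq4 : q % 4 = 1 := by
      have : q % 8 = 1 % 8 := hq8
      omega
    refine ⟨q, hqp.prime.squarefree, hqp.ne_one, coprime_of_lt q hqp hq, sum_sq q hqp hq4,
      exists_dvd_sq_sub_of_jacobiSym_eq_one hqp ?_, 1, ?_⟩
    · rw [← jacobiSym.quadratic_reciprocity_one_mod_four hq4 hodd,
        jacobiSym.mod_left' (Int.emod_eq_emod_iff_emod_sub_eq_zero.2 (Int.emod_eq_zero_of_dvd hqd)),
        jacobiSym.at_neg_one hodd, ZMod.χ₄_nat_one_mod_four hd4]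
    · rwa [show (1 : ℤ) ^ 2 + q = q - -1 by ring]
  · obtain ⟨f, hf⟩ := hodd
    obtain ⟨q, hq, hqp, hqd, hq8⟩ := exists_prime_gt_of_dvd_sub_of_mod_eight d f 1 ⟨f, hf⟩
      ⟨-2, 1, by rw [hf]; push_cast; ring⟩ odd_one d
    have hodd : Odd d := ⟨f, hf⟩
    have hq4 : q % 4 = 1 := by
      have : q % 8 = 1 % 8 := hq8
      omega
    have hqodd : Odd q := Nat.odd_iff.2 (by omega)
    have h2q : Nat.Coprime 2 q := Nat.coprime_two_left.2 hqodd
    have hdvd : (d : ℤ) ∣ 1 ^ 2 + 2 * q := by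
      obtain ⟨k, hk⟩ := hqd
      refine ⟨2 * k + 1, ?_⟩
      have hf' : (d : ℤ) = 2 * f + 1 := by exact_mod_cast hf
      linear_combination 2 * hk - hf'
    have hJ : J(d | q) = 1 := by
      rw [← jacobiSym.quadratic_reciprocity_one_mod_four hq4 hodd]
      have h : J(-2 * q | d) = J(1 | d) :=
        jacobiSym.mod_left' (Int.emod_eq_emod_iff_emod_sub_eq_zero.2 (Int.emod_eq_zero_of_dvd (by
          rwa [← dvd_neg, show -(-2 * (q : ℤ) - 1) = 1 ^ 2 + 2 * q by ring])))
      rw [jacobiSym.mul_left, jacobiSym.one_left, jacobiSym.at_neg_two hodd,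
        ZMod.χ₈'_nat_eq_if_mod_eight, if_neg (by omega), if_pos (by omega), one_mul] at h
      exact h
    obtain ⟨r, hr⟩ := exists_dvd_sq_sub_of_jacobiSym_eq_one hqp hJ
    obtain ⟨m, n, hmn⟩ := sum_sq q hqp hq4
    refine ⟨2 * q, (Nat.squarefree_mul h2q).2 ⟨Nat.prime_two.prime.squarefree,
      hqp.prime.squarefree⟩, by omega, (Nat.coprime_two_right.2 hodd).mul_right
      (coprime_of_lt q hqp hq), Nat.sq_add_sq_mul (x := 1) (y := 1) rfl hmn.symm |>.imp
      fun _ h => h.imp fun _ h => h.symm, ?_, 1, by push_cast; exact hdvd⟩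
    obtain ⟨r', hr', hr'odd⟩ : ∃ r' : ℤ, (q : ℤ) ∣ r' ^ 2 - d ∧ Odd r' := by
      rcases Int.even_or_odd r with h | h
      · refine ⟨r + q, ?_, h.add_odd (by exact_mod_cast hqodd)⟩
        rw [show (r + q) ^ 2 - (d : ℤ) = (r ^ 2 - d) + q * (2 * r + q) by ring]
        exact dvd_add hr (dvd_mul_right _ _)
      · exact ⟨r, hr, h⟩
    refine ⟨r', ?_⟩
    push_cast
    refine IsCoprime.mul_dvd (by exact_mod_cast Nat.isCoprime_iff_coprime.2 h2q) ?_ hr'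
    exact (hr'odd.pow.sub_odd (by exact_mod_cast hodd)).two_dvd

end
lemma PadicInt.one_add_sum_three_sq_ne_zero (x y z : ℤ_[2]) : 1 + x ^ 2 + y ^ 2 + z ^ 2 ≠ 0 := by
  intro h
  have h' := congrArg (PadicInt.toZModPow (p := 2) 3) h
  simp only [map_add, map_pow, map_one, map_zero] at h'
  generalize PadicInt.toZModPow (p := 2) 3 x = x' at h'
  generalize PadicInt.toZModPow (p := 2) 3 y = y' at h'
  generalize PadicInt.toZModPow (p := 2) 3 z = z' at h'
  revert x' y' z'
  change ∀ x y z : ZMod 8, _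
  decide

lemma Padic.sum_three_sq_ne_neg_one (a b c : ℚ_[2]) : a ^ 2 + b ^ 2 + c ^ 2 ≠ -1 := by
  have integral : ∀ a b c : ℚ_[2], ‖a‖ ≤ 1 → ‖b‖ ≤ 1 → ‖c‖ ≤ 1 →
      1 + a ^ 2 + b ^ 2 + c ^ 2 ≠ 0 := fun a b c ha hb hc h =>
    PadicInt.one_add_sum_three_sq_ne_zero ⟨a, ha⟩ ⟨b, hb⟩ ⟨c, hc⟩ (Subtype.ext h)
  have scaled : ∀ a b c : ℚ_[2], 1 < ‖a‖ → ‖b‖ ≤ ‖a‖ → ‖c‖ ≤ ‖a‖ →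
      a ^ 2 + b ^ 2 + c ^ 2 ≠ -1 := by
    intro a b c ha hb hc h
    have ha0 : a ≠ 0 := norm_pos_iff.1 (by linarith)
    refine integral a⁻¹ (b / a) (c / a) ?_ ?_ ?_ ?_
    · rw [norm_inv]; exact inv_le_one_of_one_le₀ ha.le
    · rw [norm_div]; exact div_le_one_of_le₀ hb (norm_nonneg _)
    · rw [norm_div]; exact div_le_one_of_le₀ hc (norm_nonneg _)
    · field_simp
      linear_combination h
  intro h
  by_cases h1 : ‖a‖ ≤ 1 ∧ ‖b‖ ≤ 1 ∧ ‖c‖ ≤ 1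
  · exact integral a b c h1.1 h1.2.1 h1.2.2 (by linear_combination h)
  by_cases ha : ‖b‖ ≤ ‖a‖ ∧ ‖c‖ ≤ ‖a‖
  · exact scaled a b c (by grind) ha.1 ha.2 h
  by_cases hb : ‖a‖ ≤ ‖b‖ ∧ ‖c‖ ≤ ‖b‖
  · exact scaled b a c (by grind) hb.1 hb.2 (by linear_combination h)
  · exact scaled c a b (by grind) (by grind) (by grind) (by linear_combination h)

lemma PadicInt.exists_sq_eq_neg_of_mod_eight_eq_seven (d : ℤ) (hd : d % 8 = 7) :
    ∃ δ : ℤ_[2], δ ^ 2 = -d := by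
  have h8 : ‖((1 + d : ℤ) : ℤ_[2])‖ ≤ (2 : ℝ) ^ (-3 : ℤ) := by
    have := (PadicInt.norm_int_le_pow_iff_dvd (p := 2) (k := 1 + d) (n := 3)).2
      (by norm_num; omega)
    exact_mod_cast this
  have h2 : ‖(2 : ℤ_[2])‖ = 2⁻¹ := by
    simpa using PadicInt.norm_p (p := 2)
  obtain ⟨δ, hδ, -⟩ := hensels_lemma (p := 2) (R := ℤ_[2])
    (F := Polynomial.X ^ 2 + Polynomial.C (d : ℤ_[2])) (a := 1) (by
      have e1 : (Polynomial.X ^ 2 + Polynomial.C (d : ℤ_[2])).aeval (1 : ℤ_[2])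
          = ((1 + d : ℤ) : ℤ_[2]) := by simp
      have e2 : (Polynomial.X ^ 2 + Polynomial.C (d : ℤ_[2])).derivative.aeval (1 : ℤ_[2])
          = 2 := by simp [one_add_one_eq_two]
      rw [e1, e2, h2]
      refine h8.trans_lt ?_
      norm_num)
  refine ⟨δ, ?_⟩
  simp at hδ
  linear_combination hδ

lemma exists_add_mul_of_adjoin_eq_top {F K : Type*} [Field F] [Field K] [Algebra F K] {θ : K}
    {m : F} (hθ : θ ^ 2 = algebraMap F K m) (hgen : Algebra.adjoin F {θ} = ⊤) (a : K) :
    ∃ x y : F, a = algebraMap F K x + algebraMap F K y * θ := by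
  have ha : a ∈ Algebra.adjoin F {θ} := hgen ▸ Algebra.mem_top
  induction ha using Algebra.adjoin_induction with
  | mem x hx => exact ⟨0, 1, by simpa using hx⟩
  | algebraMap r => exact ⟨r, 0, by simp⟩
  | add a b _ _ iha ihb =>
    obtain ⟨x, y, rfl⟩ := iha
    obtain ⟨u, v, rfl⟩ := ihb
    exact ⟨x + u, y + v, by simp only [map_add]; ring⟩
  | mul a b _ _ iha ihb =>
    obtain ⟨x, y, rfl⟩ := iha
    obtain ⟨u, v, rfl⟩ := ihb
    refine ⟨x * u + m * (y * v), x * v + y * u, ?_⟩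
    simp only [map_add, map_mul]
    linear_combination algebraMap F K y * algebraMap F K v * hθ

lemma eq_zero_of_add_mul_eq_zero {K : Type*} [Field K] [CharZero K] {d : ℤ} (hd : 0 < d) {θ : K}
    (hθ : θ ^ 2 = -(d : K)) {x y : ℚ} (h : (x : K) + y * θ = 0) : x = 0 ∧ y = 0 := by
  have hK : ((x ^ 2 + d * y ^ 2 : ℚ) : K) = 0 := by
    push_cast
    linear_combination (x - y * θ) * h + (y : K) ^ 2 * hθ
  have hQ : x ^ 2 + d * y ^ 2 = 0 := by exact_mod_cast hK
  have hd' : (0 : ℚ) < d := by exact_mod_cast hd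
  have hx : x ^ 2 = 0 := by nlinarith [sq_nonneg x, mul_nonneg hd'.le (sq_nonneg y)]
  have hy : (d : ℚ) * y ^ 2 = 0 := by nlinarith [sq_nonneg x, mul_nonneg hd'.le (sq_nonneg y)]
  have hx0 : x = 0 := by simpa using hx
  have hy0 : y = 0 := by simpa [hd.ne'] using hy
  exact ⟨hx0, hy0⟩

lemma sum_three_sq_ne_neg_one_of_mod_eight_eq_seven {K : Type*} [Field K] [CharZero K] {d : ℤ}
    (hd : 0 < d) (hd7 : d % 8 = 7) {θ : K} (hθ : θ ^ 2 = -(d : K))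
    (hgen : Algebra.adjoin ℚ {θ} = ⊤) (a b c : K) : a ^ 2 + b ^ 2 + c ^ 2 ≠ -1 := by
  intro h
  have hθ' : θ ^ 2 = algebraMap ℚ K (-d) := by simpa using hθ
  obtain ⟨x₁, y₁, rfl⟩ := exists_add_mul_of_adjoin_eq_top hθ' hgen a
  obtain ⟨x₂, y₂, rfl⟩ := exists_add_mul_of_adjoin_eq_top hθ' hgen b
  obtain ⟨x₃, y₃, rfl⟩ := exists_add_mul_of_adjoin_eq_top hθ' hgen c
  simp only [eq_ratCast] at h
  obtain ⟨hx, hy⟩ := eq_zero_of_add_mul_eq_zero hd hθ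
    (x := x₁ ^ 2 + x₂ ^ 2 + x₃ ^ 2 + 1 - d * (y₁ ^ 2 + y₂ ^ 2 + y₃ ^ 2))
    (y := 2 * (x₁ * y₁ + x₂ * y₂ + x₃ * y₃)) (by
      push_cast
      linear_combination h - ((y₁ : K) ^ 2 + y₂ ^ 2 + y₃ ^ 2) * hθ)
  obtain ⟨δ, hδ⟩ := PadicInt.exists_sq_eq_neg_of_mod_eight_eq_seven d hd7
  have hδ' : (δ : ℚ_[2]) ^ 2 = -d := by exact_mod_cast congrArg ((↑) : ℤ_[2] → ℚ_[2]) hδ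
  have hx' := congrArg ((↑) : ℚ → ℚ_[2]) hx
  have hy' := congrArg ((↑) : ℚ → ℚ_[2]) hy
  push_cast at hx' hy'
  apply Padic.sum_three_sq_ne_neg_one (x₁ + y₁ * δ) (x₂ + y₂ * δ) (x₃ + y₃ * δ)
  linear_combination hx' + δ * hy' + ((y₁ : ℚ_[2]) ^ 2 + y₂ ^ 2 + y₃ ^ 2) * hδ'

/-- Let `d` be a positive square-free integer and `K = ℚ(√−d)`.
Then `−1` is not a sum of three squares of elements of `K` iff `d ≡ 7 (mod 8)`
(equivalently, the stufe `s(K)` equals `4` exactly when `d ≡ 7 (mod 8)`). -/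
theorem neg_one_not_sum_of_three_squares_iff
    (d : ℤ) (hd : 0 < d) (hsf : Squarefree d)
    (K : Type) [Field K] [NumberField K]
    (rd : K) (hrd : rd ^ 2 = -(d : K))
    (hgen : Algebra.adjoin ℚ {rd} = ⊤) :
    (¬ ∃ a b c : K, a ^ 2 + b ^ 2 + c ^ 2 = -1) ↔ d % 8 = 7 := by
  constructor
  · intro h
    by_contra hd7
    obtain ⟨n, rfl⟩ := Int.eq_ofNat_of_zero_le hd.le
    obtain ⟨z, x₁, x₂, x₃, hz, hsum⟩ := exists_mul_sq_eq_sum_three_sq n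
      (Int.squarefree_natCast.1 hsf) (by omega)
    have hsum' := congrArg ((↑) : ℤ → K) hsum
    push_cast at hsum' hrd
    have hz' : (z : K) ≠ 0 := by exact_mod_cast hz
    have hn : (n : K) ≠ 0 := by exact_mod_cast hd.ne'
    have hrd0 : rd ≠ 0 := by
      rintro rfl
      simp_all
    refine h ⟨x₁ / (z * rd), x₂ / (z * rd), x₃ / (z * rd), ?_⟩
    field_simp
    linear_combination -hsum' + (z : K) ^ 2 * hrd
  · rintro hd7 ⟨a, b, c, h⟩
    exact sum_three_sq_ne_neg_one_of_mod_eight_eq_seven hd hd7 hrd hgen a b c h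
end

section
/- Let d be a positive square-free integer with d ≢ 7 (mod 8), and K = ℚ(√−d). Then the quaternion algebra ℍ(K) = (−1,−1/K) is isomorphic as a K-algebra to the algebra M₂(K) of 2×2 matrices over K. -/
open Quaternion

/-- A quadratic form `z² + N w² - d t²` with `N ≡ -1 mod d` and `d` a square modulo `N`
is isotropic over `ℤ`. -/
theorem exists_mul_sq_eq_sq_add_mul_sq_s2 {d N : ℕ} (hd : 0 < d) (hN : ¬ IsSquare N)
    (hdN : d ∣ N + 1) {b : ℤ} (hb : (N : ℤ) ∣ b ^ 2 - d) :
    ∃ t z w : ℤ, t ≠ 0 ∧ d * t ^ 2 = z ^ 2 + N * w ^ 2 := by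
  have hN0 : 0 < N := Nat.pos_of_ne_zero fun h => hN (h ▸ IsSquare.zero)
  have : NeZero d := ⟨hd.ne'⟩
  have : NeZero N := ⟨hN0.ne'⟩
  let S := Finset.range ((d * N).sqrt + 1) ×ˢ Finset.range (d.sqrt + 1) ×ˢ
    Finset.range (N.sqrt + 1)
  let f : ℕ × ℕ × ℕ → ZMod d × ZMod N := fun v => (v.1 - v.2.1, v.1 - b * v.2.2)
  have hcard : (Finset.univ : Finset (ZMod d × ZMod N)).card < S.card := by
    simp only [S, Finset.card_univ, Fintype.card_prod, ZMod.card, Finset.card_product,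
      Finset.card_range]
    have h1 := Nat.lt_succ_sqrt' (d * N)
    have h2 := Nat.lt_succ_sqrt' d
    have h3 := Nat.lt_succ_sqrt' N
    refine lt_of_pow_lt_pow_left₀ 2 (Nat.zero_le _) ?_
    calc (d * N) ^ 2 = (d * N) * (d * N) := sq _
      _ < (d * N).sqrt.succ ^ 2 * (d.sqrt.succ ^ 2 * N.sqrt.succ ^ 2) := by gcongr
      _ = _ := by simp only [Nat.succ_eq_add_one]; ring
  obtain ⟨⟨z₁, w₁, t₁⟩, h₁, ⟨z₂, w₂, t₂⟩, h₂, hne, heq⟩ :=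
    Finset.exists_ne_map_eq_of_card_lt_of_maps_to (f := f) hcard (fun _ _ => by simp)
  simp only [S, Finset.mem_product, Finset.mem_range, Nat.lt_succ_iff] at h₁ h₂
  simp only [f, Prod.mk.injEq] at heq
  have hsq {n u v : ℕ} (hu : u ≤ n.sqrt) (hv : v ≤ n.sqrt) : ((u : ℤ) - v) ^ 2 ≤ n := by
    have hn : ((n.sqrt : ℤ)) ^ 2 ≤ n := mod_cast Nat.sqrt_le' n
    refine le_trans (sq_le_sq' ?_ ?_) hn <;> omega
  have hz := hsq h₁.1 h₂.1
  have hw := hsq h₁.2.1 h₂.2.1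
  have ht := hsq h₁.2.2 h₂.2.2
  have hne' : ¬ ((z₁ : ℤ) - z₂ = 0 ∧ (w₁ : ℤ) - w₂ = 0 ∧ (t₁ : ℤ) - t₂ = 0) := by
    rintro ⟨h, h', h''⟩
    exact hne (by ext <;> simp <;> omega)
  have hmodd : (d : ℤ) ∣ ((z₁ : ℤ) - z₂) - (w₁ - w₂) := by
    rw [← ZMod.intCast_zmod_eq_zero_iff_dvd]
    push_cast
    linear_combination heq.1
  have hmodN : (N : ℤ) ∣ ((z₁ : ℤ) - z₂) - b * (t₁ - t₂) := by
    rw [← ZMod.intCast_zmod_eq_zero_iff_dvd]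
    push_cast
    linear_combination heq.2
  generalize (z₁ : ℤ) - z₂ = z at *
  generalize (w₁ : ℤ) - w₂ = w at *
  generalize (t₁ : ℤ) - t₂ = t at *
  have hdZ : (0 : ℤ) < d := mod_cast hd
  have hNZ : (0 : ℤ) < N := mod_cast hN0
  have hdN' : (d : ℤ) ∣ N + 1 := mod_cast hdN
  have hcop : IsCoprime (d : ℤ) N := by
    obtain ⟨k, hk⟩ := hdN'
    exact ⟨k, -1, by linear_combination -hk⟩
  have hdvd : (d * N : ℤ) ∣ z ^ 2 + N * w ^ 2 - d * t ^ 2 := by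
    refine hcop.mul_dvd ?_ ?_
    · obtain ⟨k, hk⟩ := hdN'
      obtain ⟨l, hl⟩ := hmodd
      exact ⟨l * (z + w) + k * w ^ 2 - t ^ 2, by linear_combination (z + w) * hl + w ^ 2 * hk⟩
    · obtain ⟨k, hk⟩ := hb
      obtain ⟨l, hl⟩ := hmodN
      exact ⟨l * (z + b * t) + k * t ^ 2 + w ^ 2,
        by linear_combination (z + b * t) * hl + t ^ 2 * hk⟩
  have hzero (h : d * t ^ 2 = z ^ 2 + N * w ^ 2) : t ≠ 0 := by
    rintro rfl
    have hz0 : z = 0 := by nlinarith [mul_nonneg hNZ.le (sq_nonneg w), sq_nonneg z]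
    have hw0 : w = 0 := by
      subst hz0
      have : (N : ℤ) * w ^ 2 = 0 := by linarith
      simpa [hN0.ne'] using this
    exact hne' ⟨hz0, hw0, rfl⟩
  push_cast at hz
  obtain ⟨k, hk⟩ := hdvd
  have hP : (0 : ℤ) < d * N := mul_pos hdZ hNZ
  have hNw : (N : ℤ) * w ^ 2 ≤ d * N := by
    linarith [mul_le_mul_of_nonneg_left hw hNZ.le]
  have hNw0 : 0 ≤ (N : ℤ) * w ^ 2 := by positivity
  have hdt : (d : ℤ) * t ^ 2 ≤ d * N := mul_le_mul_of_nonneg_left ht hdZ.le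
  have hdt0 : 0 ≤ (d : ℤ) * t ^ 2 := by positivity
  have hz0 := sq_nonneg z
  have hk1 : -1 ≤ k := le_of_mul_le_mul_left (by linarith) hP
  have hk2 : k ≤ 2 := le_of_mul_le_mul_left (by linarith) hP
  have : k = -1 ∨ k = 0 ∨ k = 1 ∨ k = 2 := by omega
  rcases this with rfl | rfl | rfl | rfl
  · exfalso
    have hdt' : (d : ℤ) * t ^ 2 = d * N := by linarith
    have htN : t ^ 2 = N := mul_left_cancel₀ hdZ.ne' hdt'
    exact hN (Int.isSquare_natCast_iff.1 ⟨t, by rw [← htN, sq]⟩)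
  · have h : d * t ^ 2 = z ^ 2 + N * w ^ 2 := by linear_combination -hk
    exact ⟨t, z, w, hzero h, h⟩
  · exact ⟨t ^ 2 + N, z * t + N * w, z - w * t, by positivity,
      by linear_combination -(t ^ 2 + N) * hk⟩
  · have hNw' : (N : ℤ) * w ^ 2 = N * d := by linarith
    have hwd : w ^ 2 = d := mul_left_cancel₀ hNZ.ne' hNw'
    exact ⟨1, w, 0, one_ne_zero, by rw [hwd]; ring⟩

/-- The case of `exists_mul_sq_eq_sq_add_mul_sq` in which `N` is a sum of two squares. -/
theorem exists_mul_sq_eq_sum_three_sq_of_dvd {d N : ℕ} (hd : 0 < d) (hN : ¬ IsSquare N)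
    (hdN : d ∣ N + 1) {b : ℤ} (hb : (N : ℤ) ∣ b ^ 2 - d) {u v : ℕ} (huv : N = u ^ 2 + v ^ 2) :
    ∃ t x y z : ℤ, t ≠ 0 ∧ d * t ^ 2 = x ^ 2 + y ^ 2 + z ^ 2 := by
  obtain ⟨t, z, w, ht, h⟩ := exists_mul_sq_eq_sq_add_mul_sq_s2 hd hN hdN hb
  refine ⟨t, z, u * w, v * w, ht, ?_⟩
  rw [h, huv]
  push_cast
  ring

/-- **Dirichlet's theorem** for a pair of congruences with coprime moduli. -/
theorem Nat.exists_prime_gt_and_modEq_and_modEq (n : ℕ) {M m a b : ℕ} (hM : M ≠ 0) (hm : m ≠ 0)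
    (hMm : M.Coprime m) (ha : a.Coprime M) (hb : b.Coprime m) :
    ∃ p > n, p.Prime ∧ p ≡ a [MOD M] ∧ p ≡ b [MOD m] := by
  obtain ⟨c, hcM, hcm⟩ := Nat.chineseRemainder hMm a b
  have hc : c.Coprime (M * m) :=
    Nat.Coprime.mul_right (by rw [Nat.Coprime, hcM.gcd_eq]; exact ha)
      (by rw [Nat.Coprime, hcm.gcd_eq]; exact hb)
  obtain ⟨p, hp, hpp, hpc⟩ :=
    Nat.forall_exists_prime_gt_and_modEq n (mul_ne_zero hM hm) hc
  exact ⟨p, hp, hpp, (hpc.of_mul_right m).trans hcM, (hpc.of_mul_left M).trans hcm⟩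

theorem exists_dvd_sq_sub_of_jacobiSym_eq_one_s2 {p d : ℕ} (hp : p.Prime)
    (h : jacobiSym d p = 1) : ∃ b : ℤ, (p : ℤ) ∣ b ^ 2 - d := by
  have : Fact p.Prime := ⟨hp⟩
  obtain ⟨c, hc⟩ := ZMod.isSquare_of_jacobiSym_eq_one h
  obtain ⟨b, rfl⟩ := ZMod.intCast_surjective c
  refine ⟨b, ?_⟩
  rw [← ZMod.intCast_zmod_eq_zero_iff_dvd]
  push_cast at hc ⊢
  rw [hc]
  ring

theorem jacobiSym_eq_of_dvd_sub {a b : ℤ} {m : ℕ} (h : (m : ℤ) ∣ b - a) :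
    jacobiSym a m = jacobiSym b m :=
  jacobiSym.mod_left' (Int.modEq_iff_dvd.2 h)

theorem Nat.ModEq.dvd_add_one {m p : ℕ} (hm : 0 < m) (h : p ≡ m - 1 [MOD m]) : m ∣ p + 1 := by
  have h' := h.add_right 1
  rw [Nat.sub_add_cancel hm] at h'
  exact Nat.modEq_zero_iff_dvd.1 (h'.trans (by simp [Nat.ModEq]))

theorem Nat.coprime_sub_one_self {m : ℕ} (hm : 0 < m) : (m - 1).Coprime m := by
  obtain ⟨k, rfl⟩ := Nat.exists_eq_add_of_lt hm
  simp

theorem exists_mul_sq_eq_sum_three_sq_of_mod_four_eq_one {d : ℕ} (hd : d % 4 = 1) :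
    ∃ t x y z : ℤ, t ≠ 0 ∧ d * t ^ 2 = x ^ 2 + y ^ 2 + z ^ 2 := by
  have hd0 : 0 < d := by omega
  have hodd : Odd d := Nat.odd_iff.2 (by omega)
  obtain ⟨p, -, hp, hp4, hpd⟩ := Nat.exists_prime_gt_and_modEq_and_modEq 0 (M := 4) (m := d)
    (a := 1) (by norm_num) hd0.ne' (hodd.coprime_two_left.pow_left 2) (by norm_num)
    (Nat.coprime_sub_one_self hd0)
  replace hp4 : p % 4 = 1 := hp4
  have hdvd := hpd.dvd_add_one hd0
  have hJ : jacobiSym d p = 1 := by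
    rw [jacobiSym.quadratic_reciprocity_one_mod_four hd (Nat.odd_iff.2 (by omega)),
      jacobiSym_eq_of_dvd_sub (b := -1), jacobiSym.at_neg_one hodd,
      ZMod.χ₄_nat_one_mod_four hd]
    obtain ⟨k, hk⟩ := hdvd
    exact ⟨-k, by zify at hk; linear_combination -hk⟩
  obtain ⟨b, hb⟩ := exists_dvd_sq_sub_of_jacobiSym_eq_one_s2 hp hJ
  have : Fact p.Prime := ⟨hp⟩
  obtain ⟨u, v, huv⟩ := Nat.Prime.sq_add_sq (p := p) (by omega)
  exact exists_mul_sq_eq_sum_three_sq_of_dvd hd0 hp.prime.not_isSquare hdvd hb huv.symm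

theorem exists_mul_sq_eq_sum_three_sq_of_mod_four_eq_two {d : ℕ} (hd : d % 4 = 2) :
    ∃ t x y z : ℤ, t ≠ 0 ∧ d * t ^ 2 = x ^ 2 + y ^ 2 + z ^ 2 := by
  obtain ⟨m, rfl⟩ : ∃ m, d = 2 * m := ⟨d / 2, by omega⟩
  have hm0 : 0 < m := by omega
  have hodd : Odd m := Nat.odd_iff.2 (by omega)
  obtain ⟨a, ha8, ham⟩ : ∃ a : ℕ, a.Coprime 8 ∧ ∀ p : ℕ, p % 8 = a % 8 →
      p % 4 = 1 ∧ ZMod.χ₈ p * ZMod.χ₄ m = 1 := by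
    have : m % 4 = 1 ∨ m % 4 = 3 := by omega
    rcases this with h | h
    · refine ⟨1, by norm_num, fun p hp => ⟨by omega, ?_⟩⟩
      rw [ZMod.χ₄_nat_one_mod_four h, ZMod.χ₈_nat_eq_if_mod_eight, if_neg (by omega),
        if_pos (by omega), one_mul]
    · refine ⟨5, by norm_num, fun p hp => ⟨by omega, ?_⟩⟩
      rw [ZMod.χ₄_nat_three_mod_four h, ZMod.χ₈_nat_eq_if_mod_eight, if_neg (by omega),
        if_neg (by omega)]
      norm_num
  obtain ⟨p, -, hp, hp8, hpm⟩ := Nat.exists_prime_gt_and_modEq_and_modEq 0 (M := 8) (m := m)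
    (by norm_num) hm0.ne' (hodd.coprime_two_left.pow_left 3) ha8 (Nat.coprime_sub_one_self hm0)
  obtain ⟨hp4, hχ⟩ := ham p hp8
  have hpodd : Odd p := Nat.odd_iff.2 (by omega)
  have hdvd := hpm.dvd_add_one hm0
  have hJ : jacobiSym (2 * m : ℕ) p = 1 := by
    push_cast
    rw [jacobiSym.mul_left, jacobiSym.at_two hpodd,
      ← jacobiSym.quadratic_reciprocity_one_mod_four hp4 hodd,
      jacobiSym_eq_of_dvd_sub (b := -1), jacobiSym.at_neg_one hodd, hχ]
    obtain ⟨k, hk⟩ := hdvd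
    exact ⟨-k, by zify at hk; linear_combination -hk⟩
  have hdvd' : 2 * m ∣ p + 1 :=
    hodd.coprime_two_left.mul_dvd_of_dvd_of_dvd (by omega) hdvd
  obtain ⟨b, hb⟩ := exists_dvd_sq_sub_of_jacobiSym_eq_one_s2 hp hJ
  have : Fact p.Prime := ⟨hp⟩
  obtain ⟨u, v, huv⟩ := Nat.Prime.sq_add_sq (p := p) (by omega)
  exact exists_mul_sq_eq_sum_three_sq_of_dvd (by omega) hp.prime.not_isSquare hdvd' hb huv.symm

theorem exists_mul_sq_eq_sum_three_sq_of_mod_eight_eq_three {d : ℕ} (hd : d % 8 = 3) :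
    ∃ t x y z : ℤ, t ≠ 0 ∧ d * t ^ 2 = x ^ 2 + y ^ 2 + z ^ 2 := by
  have hd0 : 0 < d := by omega
  have hodd : Odd d := Nat.odd_iff.2 (by omega)
  have hcop : (d / 2).Coprime d := by
    obtain ⟨k, hk⟩ := hodd
    rw [show d / 2 = k by omega, hk]
    simp
  obtain ⟨p, hp2, hp, hp4, hpd⟩ := Nat.exists_prime_gt_and_modEq_and_modEq 2 (M := 4) (m := d)
    (a := 1) (by norm_num) hd0.ne' (hodd.coprime_two_left.pow_left 2) (by norm_num) hcop
  replace hp4 : p % 4 = 1 := hp4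
  have hdvd : d ∣ 2 * p + 1 := by
    refine Nat.ModEq.dvd_add_one hd0 ?_
    have h := hpd.mul_left 2
    rwa [show 2 * (d / 2) = d - 1 by omega] at h
  have hJ : jacobiSym d p = 1 := by
    rw [← jacobiSym.quadratic_reciprocity_one_mod_four hp4 hodd]
    have h1 : jacobiSym (-2 * p) d = 1 := by
      rw [jacobiSym_eq_of_dvd_sub (b := 1), jacobiSym.one_left]
      obtain ⟨k, hk⟩ := hdvd
      exact ⟨k, by zify at hk; linear_combination hk⟩
    rwa [jacobiSym.mul_left, jacobiSym.at_neg_two hodd, ZMod.χ₈'_nat_eq_if_mod_eight,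
      if_neg (by omega), if_pos (Or.inr hd), one_mul] at h1
  obtain ⟨b, hb⟩ := exists_dvd_sq_sub_of_jacobiSym_eq_one_s2 hp hJ
  obtain ⟨c, hc⟩ : ∃ c : ℤ, ((2 * p : ℕ) : ℤ) ∣ c ^ 2 - d := by
    have hcop : IsCoprime (2 : ℤ) p :=
      Nat.isCoprime_iff_coprime.2 (Nat.coprime_two_left.2 (Nat.odd_iff.2 (by omega)))
    push_cast
    rcases Int.even_or_odd b with h | h
    · refine ⟨b + p, hcop.mul_dvd ?_ ?_⟩
      · have hpo : Odd (p : ℤ) := Int.odd_iff.2 (by omega)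
        have hdo : Odd (d : ℤ) := Int.odd_iff.2 (by omega)
        exact ((h.add_odd hpo).pow.sub_odd hdo).two_dvd
      · rw [show (b + p) ^ 2 - (d : ℤ) = b ^ 2 - d + p * (2 * b + p) by ring]
        exact hb.add (dvd_mul_right _ _)
    · have hdo : Odd (d : ℤ) := Int.odd_iff.2 (by omega)
      exact ⟨b, hcop.mul_dvd (h.pow.sub_odd hdo).two_dvd hb⟩
  have hsq : ¬ IsSquare (2 * p) := by
    rintro ⟨c, hc⟩
    obtain ⟨e, rfl⟩ : p ∣ c := (hp.dvd_mul.1 (hc ▸ dvd_mul_left p 2)).elim id id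
    have : 2 = p * (e * e) := Nat.eq_of_mul_eq_mul_left hp.pos (by linarith)
    exact absurd (Nat.le_of_dvd two_pos ⟨_, this⟩) (by omega)
  have : Fact p.Prime := ⟨hp⟩
  obtain ⟨u, v, huv⟩ := Nat.Prime.sq_add_sq (p := p) (by omega)
  obtain ⟨r, s, hrs⟩ := Nat.sq_add_sq_mul (a := 2) (b := p) (x := 1) (y := 1) rfl huv.symm
  exact exists_mul_sq_eq_sum_three_sq_of_dvd hd0 hsq hdvd hc hrs

/-- A weak form of the three squares theorem. -/
theorem exists_mul_sq_eq_sum_three_sq_s2 {d : ℕ} (h4 : d % 4 ≠ 0) (h8 : d % 8 ≠ 7) :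
    ∃ t x y z : ℤ, t ≠ 0 ∧ d * t ^ 2 = x ^ 2 + y ^ 2 + z ^ 2 := by
  have : d % 4 = 1 ∨ d % 4 = 2 ∨ d % 8 = 3 := by omega
  rcases this with h | h | h
  · exact exists_mul_sq_eq_sum_three_sq_of_mod_four_eq_one h
  · exact exists_mul_sq_eq_sum_three_sq_of_mod_four_eq_two h
  · exact exists_mul_sq_eq_sum_three_sq_of_mod_eight_eq_three h

/-- If `-1` is a sum of two squares, the quaternion algebra splits. -/
theorem Quaternion.nonempty_algEquiv_matrix {K : Type*} [Field K] [NeZero (2 : K)] {a b : K}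
    (hab : a ^ 2 + b ^ 2 = -1) : Nonempty (ℍ[K] ≃ₐ[K] Matrix (Fin 2) (Fin 2) K) := by
  let B : QuaternionAlgebra.Basis (Matrix (Fin 2) (Fin 2) K) (-1 : K) 0 (-1) :=
    { i := !![0, -1; 1, 0]
      j := !![a, b; b, -a]
      k := !![-b, a; a, b]
      i_mul_i := by ext i j; fin_cases i <;> fin_cases j <;> simp
      j_mul_j := by
        ext i j
        fin_cases i <;> fin_cases j <;> simp
        · linear_combination hab
        · ring
        · ring
        · linear_combination hab
      i_mul_j := by ext i j; fin_cases i <;> fin_cases j <;> simp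
      j_mul_i := by ext i j; fin_cases i <;> fin_cases j <;> simp }
  let φ : ℍ[K] →ₐ[K] Matrix (Fin 2) (Fin 2) K := B.liftHom
  have hφ (q : ℍ[K]) : φ q =
      !![q.re + a * q.imJ - b * q.imK, -q.imI + b * q.imJ + a * q.imK;
        q.imI + b * q.imJ + a * q.imK, q.re - a * q.imJ + b * q.imK] := by
    change B.lift q = _
    ext i j
    fin_cases i <;> fin_cases j <;>
      simp [B, QuaternionAlgebra.Basis.lift,
        Matrix.algebraMap_matrix_apply] <;> ring
  have h2 : (2 : K) ≠ 0 := NeZero.ne _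
  refine ⟨AlgEquiv.ofBijective φ ⟨?_, fun M => ?_⟩⟩
  · refine (injective_iff_map_eq_zero _).2 fun q hq => ?_
    rw [hφ] at hq
    have h00 := congrFun (congrFun hq 0) 0
    have h01 := congrFun (congrFun hq 0) 1
    have h10 := congrFun (congrFun hq 1) 0
    have h11 := congrFun (congrFun hq 1) 1
    simp at h00 h01 h10 h11
    ext <;> simp <;> refine (mul_eq_zero.1 ?_).resolve_left h2
    · linear_combination h00 + h11
    · linear_combination h10 - h01
    · linear_combination -a * (h00 - h11) - b * (h01 + h10) + 2 * q.imJ * hab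
    · linear_combination b * (h00 - h11) - a * (h01 + h10) + 2 * q.imK * hab
  · refine ⟨⟨(M 0 0 + M 1 1) / 2, (M 1 0 - M 0 1) / 2,
      -(a * (M 0 0 - M 1 1) + b * (M 0 1 + M 1 0)) / 2,
      (b * (M 0 0 - M 1 1) - a * (M 0 1 + M 1 0)) / 2⟩, (hφ _).trans ?_⟩
    ext i j
    fin_cases i <;> fin_cases j <;> simp <;> field_simp
    · linear_combination -(M 0 0 - M 1 1) * hab
    · linear_combination -(M 0 1 + M 1 0) * hab
    · linear_combination -(M 0 1 + M 1 0) * hab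
    · linear_combination (M 0 0 - M 1 1) * hab

/-- A field in which a sum of four squares, the first of them nonzero, vanishes has `-1` as
a sum of two squares. -/
theorem exists_sq_add_sq_eq_neg_one {K : Type*} [Field K] {r x y z : K} (hr : r ≠ 0)
    (h : r ^ 2 + x ^ 2 + y ^ 2 + z ^ 2 = 0) : ∃ a b : K, a ^ 2 + b ^ 2 = -1 := by
  by_cases hs : r ^ 2 + x ^ 2 = 0
  · exact ⟨x / r, 0, by field_simp; linear_combination hs⟩
  · refine ⟨(r * y + x * z) / (r ^ 2 + x ^ 2), (r * z - x * y) / (r ^ 2 + x ^ 2), ?_⟩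
    field_simp
    linear_combination (r ^ 2 + x ^ 2) * h

/-- Let `d` be a positive square-free integer with `d ≢ 7 (mod 8)`,
and `K = ℚ(√−d)`. Then the quaternion algebra `ℍ(K) = (−1,−1 / K)` is isomorphic,
as a `K`-algebra, to the algebra of `2 × 2` matrices over `K`. -/
theorem quaternion_algebra_iso_matrix
    (d : ℤ) (hd : 0 < d) (hsf : Squarefree d) (hd7 : d % 8 ≠ 7)
    (K : Type) [Field K] [NumberField K]
    (rd : K) (hrd : rd ^ 2 = -(d : K))
    (hgen : Algebra.adjoin ℚ {rd} = ⊤) :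
    Nonempty (ℍ[K] ≃ₐ[K] Matrix (Fin 2) (Fin 2) K) := by
  have h4 : d % 4 ≠ 0 := fun h => by
    have h2 : (2 : ℤ) * 2 ∣ d := Int.dvd_of_emod_eq_zero h
    have := Int.isUnit_iff.1 (hsf 2 h2)
    omega
  lift d to ℕ using hd.le
  obtain ⟨t, x, y, z, ht, h⟩ := exists_mul_sq_eq_sum_three_sq_s2 (d := d) (by omega) (by omega)
  have hrd0 : rd ≠ 0 := by
    rintro rfl
    have : (d : K) = 0 := by simpa using hrd
    have : d = 0 := mod_cast this
    omega
  have hK : (d : K) * t ^ 2 = x ^ 2 + y ^ 2 + z ^ 2 := mod_cast congrArg (Int.cast (R := K)) h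
  push_cast at hrd
  obtain ⟨a, b, hab⟩ := exists_sq_add_sq_eq_neg_one (r := rd * t) (x := x) (y := y) (z := z)
    (mul_ne_zero hrd0 (mod_cast ht)) (by linear_combination t ^ 2 * hrd - hK)
  exact Quaternion.nonempty_algEquiv_matrix hab
end

section
/- Let d be a positive square-free integer with d ≡ 7 (mod 8), K = ℚ(√−d), R = 𝓞_K, and let u = u₁ + u_i i + u_j j + u_k k ∈ ℍ(R) have norm η(u) = 1. Then u has finite multiplicative order if and only if u₁ ∈ {−1, 0, 1}; moreover, in that case the order of u is 1, 2 or 4 (in particular u⁴ = 1). -/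
open Quaternion NumberField

/-- Over `ℚ₂`, a coordinate of maximal norm in a zero of `x² + y² + z²` vanishes. -/
lemma Padic.eq_zero_of_sq_add_sq_add_sq_of_norm_le {x y z : ℚ_[2]}
    (hy : ‖y‖ ≤ ‖x‖) (hz : ‖z‖ ≤ ‖x‖) (h : x ^ 2 + y ^ 2 + z ^ 2 = 0) : x = 0 := by
  by_contra hx
  have hx' : 0 < ‖x‖ := norm_pos_iff.mpr hx
  have norm_div_le {w : ℚ_[2]} (hw : ‖w‖ ≤ ‖x‖) : ‖w / x‖ ≤ 1 := by
    rw [norm_div]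
    exact div_le_one_of_le₀ hw hx'.le
  obtain ⟨a, ha⟩ : ∃ a : ℤ_[2], (a : ℚ_[2]) = y / x := ⟨⟨y / x, norm_div_le hy⟩, rfl⟩
  obtain ⟨b, hb⟩ : ∃ b : ℤ_[2], (b : ℚ_[2]) = z / x := ⟨⟨z / x, norm_div_le hz⟩, rfl⟩
  have hab : 1 + a ^ 2 + b ^ 2 = 0 := by
    apply Subtype.val_injective
    push_cast
    rw [ha, hb]
    field_simp
    simpa using h
  have hmod : ∀ a b : ZMod (2 ^ 2), 1 + a ^ 2 + b ^ 2 ≠ 0 := by decide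
  apply hmod (PadicInt.toZModPow 2 a) (PadicInt.toZModPow 2 b)
  simpa using congrArg (PadicInt.toZModPow 2) hab

/-- The form `x² + y² + z²` is anisotropic over `ℚ₂`. -/
lemma Padic.sq_add_sq_add_sq_eq_zero_iff {x y z : ℚ_[2]} :
    x ^ 2 + y ^ 2 + z ^ 2 = 0 ↔ x = 0 ∧ y = 0 ∧ z = 0 := by
  refine ⟨fun h => ?_, by rintro ⟨rfl, rfl, rfl⟩; simp⟩
  have eq_zero_of_isMax {w : ℚ_[2]} (hw : w = 0)
      (h₁ : ‖x‖ ≤ ‖w‖) (h₂ : ‖y‖ ≤ ‖w‖) (h₃ : ‖z‖ ≤ ‖w‖) : x = 0 ∧ y = 0 ∧ z = 0 := by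
    simp_all
  rcases le_total ‖x‖ ‖y‖ with hxy | hxy <;> rcases le_total ‖y‖ ‖z‖ with hyz | hyz <;>
    rcases le_total ‖x‖ ‖z‖ with hxz | hxz
  all_goals first
    | exact eq_zero_of_isMax (eq_zero_of_sq_add_sq_add_sq_of_norm_le
        (x := x) (y := y) (z := z) (by linarith) (by linarith) h)
        (by linarith) (by linarith) (by linarith)
    | exact eq_zero_of_isMax (eq_zero_of_sq_add_sq_add_sq_of_norm_le
        (x := y) (y := z) (z := x) (by linarith) (by linarith) (by linear_combination h))
        (by linarith) (by linarith) (by linarith)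
    | exact eq_zero_of_isMax (eq_zero_of_sq_add_sq_add_sq_of_norm_le
        (x := z) (y := x) (z := y) (by linarith) (by linarith) (by linear_combination h))
        (by linarith) (by linarith) (by linarith)

/-- An integer congruent to `1` modulo `8` is a square in `ℤ₂`. -/
lemma PadicInt.isSquare_intCast_of_emod_eight {n : ℤ} (hn : n % 8 = 1) :
    IsSquare (n : ℤ_[2]) := by
  obtain ⟨z, hz, -⟩ := hensels_lemma (p := 2) (R := ℤ_[2])
    (F := Polynomial.X ^ 2 - Polynomial.C (n : ℤ_[2])) (a := 1) (by
      have h8 : ‖((1 - n : ℤ) : ℤ_[2])‖ ≤ (2 : ℝ) ^ (-(3 : ℕ) : ℤ) := by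
        have := (PadicInt.norm_int_le_pow_iff_dvd (p := 2) (k := 1 - n) (n := 3)).mpr
          (by norm_num; omega)
        exact_mod_cast this
      have h2 : ‖(2 : ℤ_[2])‖ = 2⁻¹ := by
        simpa using PadicInt.norm_p (p := 2)
      simp [one_add_one_eq_two, h2]
      push_cast at h8
      refine h8.trans_lt ?_
      norm_num)
  refine ⟨z, ?_⟩
  simp [sub_eq_zero] at hz
  rw [← hz, sq]

lemma nonempty_ringHom_padic_two {K : Type*} [Field K] [CharZero K] {n : ℤ} (hn : n % 8 = 1)
    {r : K} (hr : r ^ 2 = n) (hgen : Algebra.adjoin ℚ {r} = ⊤) : Nonempty (K →+* ℚ_[2]) := by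
  obtain ⟨s, hs⟩ := PadicInt.isSquare_intCast_of_emod_eight hn
  have hs' : (n : ℚ_[2]) = s * s := by exact_mod_cast congrArg Subtype.val hs
  set F : Polynomial ℚ := Polynomial.X ^ 2 - Polynomial.C (n : ℚ) with hF
  have hmonic : F.Monic := Polynomial.monic_X_pow_sub_C _ two_ne_zero
  have hroot : Polynomial.aeval r F = 0 := by simp [hF, hr]
  have hsplit : (F.map (algebraMap ℚ ℚ_[2])).Splits := by
    have : F.map (algebraMap ℚ ℚ_[2]) =
        (Polynomial.X - Polynomial.C (s : ℚ_[2])) * (Polynomial.X + Polynomial.C (s : ℚ_[2])) := by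
      rw [hF, Polynomial.map_sub, Polynomial.map_pow, Polynomial.map_X, Polynomial.map_C,
        map_intCast (algebraMap ℚ ℚ_[2]), hs', Polynomial.C_mul]
      ring
    rw [this]
    exact (Polynomial.Splits.X_sub_C _).mul (Polynomial.Splits.X_add_C _)
  have htop : IntermediateField.adjoin ℚ {r} = ⊤ := by
    rw [← top_le_iff, ← IntermediateField.toSubalgebra_le_toSubalgebra]
    simpa [hgen] using IntermediateField.algebra_adjoin_le_adjoin ℚ {r}
  obtain ⟨f⟩ := IntermediateField.nonempty_algHom_of_adjoin_splits (K := ℚ_[2]) (fun x hx => by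
    rw [Set.mem_singleton_iff] at hx
    subst hx
    refine ⟨⟨F, hmonic, hroot⟩, hsplit.of_dvd ?_ ?_⟩
    · exact (hmonic.map _).ne_zero
    · exact Polynomial.map_dvd _ (minpoly.dvd ℚ x hroot)) htop
  exact ⟨f.toRingHom⟩

namespace Quaternion

variable {R : Type*} [CommRing R]

lemma sq_eq_of_normSq_eq_one {u : ℍ[R]} (hu : normSq u = 1) :
    u ^ 2 = (2 * u.re) • u - 1 := by
  rw [normSq_def'] at hu
  rw [sq]
  ext <;> simp <;> first | linear_combination -hu | ring

/-- Powers of a norm one quaternion `u` are linear in `u`, with the same coefficients as for any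
root of the characteristic polynomial of `u`. -/
lemma exists_pow_eq_smul_add {u : ℍ[R]} (hu : normSq u = 1) (n : ℕ) :
    ∃ a b : R, u ^ n = a • u + (b : ℍ[R]) ∧
      ∀ {S : Type} [CommRing S] (φ : R →+* S) (z : S),
        z ^ 2 = 2 * φ u.re * z - 1 → z ^ n = φ a * z + φ b := by
  induction n with
  | zero => exact ⟨0, 1, by simp, by simp⟩
  | succ n ih =>
    obtain ⟨a, b, h, hz⟩ := ih
    refine ⟨2 * u.re * a + b, -a, ?_, fun φ z hφ => ?_⟩
    · rw [pow_succ, h, add_mul, smul_mul_assoc, ← sq, sq_eq_of_normSq_eq_one hu]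
      ext <;> simp <;> ring
    · rw [pow_succ, hz φ z hφ]
      simp only [map_add, map_mul, map_neg, map_ofNat]
      linear_combination φ a * hφ

/-- Over a domain, a norm one quaternion of finite order is a scalar, or all complex embeddings of
its characteristic polynomial have only roots of unity as roots. -/
lemma re_sq_eq_one_or_pow_eq_one [IsDomain R] {u : ℍ[R]} (hu : normSq u = 1) {n : ℕ}
    (hn : u ^ n = 1) : u.re ^ 2 = 1 ∨
      ∀ {S : Type} [CommRing S] (φ : R →+* S) (z : S),
        z ^ 2 = 2 * φ u.re * z - 1 → z ^ n = 1 := by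
  obtain ⟨a, b, h, hz⟩ := exists_pow_eq_smul_add hu n
  rw [hn, Quaternion.ext_iff] at h
  simp only [re_one, imI_one, imJ_one, imK_one, re_add, imI_add, imJ_add, imK_add, re_smul,
    imI_smul, imJ_smul, imK_smul, re_coe, imI_coe, imJ_coe, imK_coe, smul_eq_mul, add_zero,
    zero_eq_mul] at h
  obtain ⟨hre, hi, hj, hk⟩ := h
  by_cases ha : a = 0
  · right
    intro S _ φ z hφ
    have hb : b = 1 := by simpa [ha] using hre.symm
    simpa [ha, hb] using hz φ z hφ
  · left
    rw [normSq_def'] at hu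
    simpa [hi.resolve_left ha, hj.resolve_left ha, hk.resolve_left ha] using hu

end Quaternion

/-- If the roots of `z² - 2cz + 1` are complex roots of unity, then `c` is real of norm at most
one. -/
lemma Complex.norm_le_one_and_conj_eq_of_pow_eq_one {c : ℂ} {n : ℕ} (hn : n ≠ 0)
    (h : ∀ z : ℂ, z ^ 2 = 2 * c * z - 1 → z ^ n = 1) :
    ‖c‖ ≤ 1 ∧ (starRingEnd ℂ) c = c := by
  obtain ⟨s, hs⟩ := IsAlgClosed.exists_pow_nat_eq (c ^ 2 - 1) two_pos
  have hz := h (c + s) (by linear_combination hs)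
  have hnorm : ‖c + s‖ = 1 := norm_eq_one_of_pow_eq_one hz hn
  have hinv : (starRingEnd ℂ) (c + s) = c - s := by
    rw [← Complex.inv_eq_conj hnorm]
    exact (eq_inv_of_mul_eq_one_left (by linear_combination -hs)).symm
  have hc : c = ((c + s).re : ℂ) := by
    have := Complex.add_conj (c + s)
    rw [hinv] at this
    push_cast at this
    linear_combination this / 2
  constructor
  · rw [hc, Complex.norm_real, ← hnorm]
    exact Complex.abs_re_le_norm _
  · rw [hc, Complex.conj_ofReal]

/-- The real part of a norm one quaternion of finite order over a ring of integers. -/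
lemma Quaternion.re_eq_of_isOfFinOrder {K : Type*} [Field K] [NumberField K] {u : ℍ[𝓞 K]}
    (hu : normSq u = 1) (h : IsOfFinOrder u) : u.re = -1 ∨ u.re = 0 ∨ u.re = 1 := by
  obtain ⟨n, hn, hun⟩ := isOfFinOrder_iff_pow_eq_one.mp h
  rcases re_sq_eq_one_or_pow_eq_one hu hun with h1 | hz
  · rcases mul_self_eq_one_iff.mp ((sq u.re).symm.trans h1) with h1 | h1 <;> simp [h1]
  have key (φ : K →+* ℂ) : ‖φ u.re‖ ≤ 1 ∧ (starRingEnd ℂ) (φ u.re) = φ u.re :=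
    Complex.norm_le_one_and_conj_eq_of_pow_eq_one hn.ne'
      fun z => hz (φ.comp (algebraMap (𝓞 K) K)) z
  by_cases h0 : u.re = 0
  · exact .inr (.inl h0)
  obtain ⟨m, hm, hum⟩ := NumberField.Embeddings.pow_eq_one_of_norm_le_one K ℂ
    (x := (u.re : K)) (by simpa using h0) u.re.isIntegral_coe fun φ => (key φ).1
  obtain ⟨φ⟩ : Nonempty (K →+* ℂ) := inferInstance
  have hnorm : ‖φ u.re‖ = 1 :=
    Complex.norm_eq_one_of_pow_eq_one (by rw [← map_pow, hum, map_one]) hm.ne'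
  have hsq : φ u.re * φ u.re = 1 := by
    have := Complex.mul_conj (φ u.re)
    rw [(key φ).2, Complex.normSq_eq_norm_sq, hnorm] at this
    simpa using this
  have hone : u.re * u.re = 1 := by
    apply RingOfIntegers.ext
    apply φ.injective
    simpa using hsq
  rcases mul_self_eq_one_iff.mp hone with h1 | h1 <;> simp [h1]

/-- Let `d > 0` be square-free with `d ≡ 7 (mod 8)`, `K = ℚ(√−d)`,
`R = 𝓞 K`, and let `u ∈ ℍ(R)` have norm `η(u) = 1`. Then `u` has finite multiplicative
order iff `u₁ ∈ {−1, 0, 1}`; moreover, in that case the order of `u` is `1`, `2` or `4`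
(in particular `u⁴ = 1`). -/
theorem quaternion_order_norm_one_torsion_iff
    (d : ℤ) (hd : 0 < d) (hsf : Squarefree d) (hd7 : d % 8 = 7)
    (K : Type) [Field K] [NumberField K]
    (rd : 𝓞 K) (hrd : rd ^ 2 = -(d : 𝓞 K))
    (hgen : Algebra.adjoin ℚ {(rd : K)} = ⊤)
    (u : ℍ[𝓞 K]) (hu : Quaternion.normSq u = 1) :
    (IsOfFinOrder u ↔ u.re = -1 ∨ u.re = 0 ∨ u.re = 1) ∧
      (IsOfFinOrder u → (orderOf u = 1 ∨ orderOf u = 2 ∨ orderOf u = 4) ∧ u ^ 4 = 1) := by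
  have hd' : (-d) % 8 = 1 := by omega
  have hr : (rd : K) ^ 2 = ((-d : ℤ) : K) := by
    have := congrArg (algebraMap (𝓞 K) K) hrd
    simpa using this
  obtain ⟨f⟩ := nonempty_ringHom_padic_two hd' hr hgen
  have hf : Function.Injective (f.comp (algebraMap (𝓞 K) K)) :=
    f.injective.comp RingOfIntegers.coe_injective
  have hnorm := hu
  rw [Quaternion.normSq_def'] at hnorm
  have him (h : u.re ^ 2 = 1) : u.imI = 0 ∧ u.imJ = 0 ∧ u.imK = 0 := by
    have hsum : u.imI ^ 2 + u.imJ ^ 2 + u.imK ^ 2 = 0 := by linear_combination hnorm - h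
    have := congrArg (f.comp (algebraMap (𝓞 K) K)) hsum
    rw [map_add, map_add, map_pow, map_pow, map_pow, map_zero,
      Padic.sq_add_sq_add_sq_eq_zero_iff] at this
    simpa only [map_eq_zero_iff _ hf] using this
  have order (h : u.re = -1 ∨ u.re = 0 ∨ u.re = 1) :
      orderOf u = 1 ∨ orderOf u = 2 ∨ orderOf u = 4 := by
    rcases h with h | h | h
    · obtain ⟨hi, hj, hk⟩ := him (by simp [h])
      have hu1 : u = -1 := by ext <;> simp [h, hi, hj, hk]
      rw [hu1]
      right; left
      refine orderOf_eq_prime (by simp) fun h1 => ?_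
      have := congrArg QuaternionAlgebra.re h1
      norm_num at this
    · have hsq : u ^ 2 = -1 := by simp [Quaternion.sq_eq_of_normSq_eq_one hu, h]
      right; right
      refine orderOf_eq_prime_pow (p := 2) (n := 1) ?_ ?_
      · rw [pow_one, hsq]
        intro h1
        have := congrArg QuaternionAlgebra.re h1
        norm_num at this
      · rw [show 2 ^ (1 + 1) = 2 * 2 from rfl, pow_mul, hsq]
        simp
    · obtain ⟨hi, hj, hk⟩ := him (by simp [h])
      left
      rw [orderOf_eq_one_iff]
      ext <;> simp [h, hi, hj, hk]
  refine ⟨⟨Quaternion.re_eq_of_isOfFinOrder hu, fun h => ?_⟩, fun h => ?_⟩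
  · rw [← orderOf_pos_iff]
    rcases order h with h | h | h <;> simp [h]
  · have ho := order (Quaternion.re_eq_of_isOfFinOrder hu h)
    refine ⟨ho, orderOf_dvd_iff_pow_eq_one.mp ?_⟩
    rcases ho with h | h | h <;> norm_num [h]
end

section
/- Let d be a positive square-free integer with d ≡ 2 or 3 (mod 4), K = ℚ(√−d), R = 𝓞_K, and let p, m be rational integers. The element u = p + (m√−d)·i ∈ ℍ(R) is a unit of ℍ(R) if and only if ε = p + m√d is a unit of the ring of integers ℤ[√d] of 𝕃 = ℚ(√d), i.e., if and only if p² − d m² = ±1. -/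
open Quaternion NumberField

/-- A quaternion over a commutative ring is a unit as soon as its norm is. -/
theorem Quaternion.isUnit_iff_isUnit_normSq {A : Type*} [CommRing A] (a : ℍ[A]) :
    IsUnit a ↔ IsUnit (normSq a) := by
  refine ⟨fun h => h.map normSq, fun h => ?_⟩
  obtain ⟨b, hb⟩ := h.exists_right_inv
  have hb' : ((normSq a : A) : ℍ[A]) * (b : ℍ[A]) = 1 := by
    rw [← coe_mul, hb, coe_one]
  refine isUnit_iff_exists.2 ⟨star a * b, ?_, ?_⟩
  · rw [← mul_assoc, self_mul_star, hb']
  · rw [mul_assoc, (coe_commutes b a), ← mul_assoc, star_mul_self, hb']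

/-- A rational integer is a unit in the ring of integers of a number field iff it is a unit
in `ℤ`. -/
theorem NumberField.RingOfIntegers.isUnit_intCast_iff (K : Type*) [Field K] [NumberField K]
    (n : ℤ) : IsUnit (n : 𝓞 K) ↔ IsUnit n := by
  refine ⟨fun h => ?_, fun h => h.map (Int.castRingHom (𝓞 K))⟩
  have hn := h.map (Algebra.norm ℤ)
  rw [← eq_intCast (algebraMap ℤ (𝓞 K)), Algebra.norm_algebraMap] at hn
  exact (isUnit_pow_iff Module.finrank_pos.ne').1 hn

/-- Let `d > 0` be square-free with `d ≡ 2` or `3 (mod 4)`,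
`K = ℚ(√−d)`, `R = 𝓞 K`, and let `p, m` be rational integers. The element
`u = p + (m√−d)·i ∈ ℍ(R)` is a unit of `ℍ(R)` iff `ε = p + m√d` is a unit of
`ℤ[√d]`, i.e. iff `p² − d·m² = ±1`. -/
theorem quaternion_pell_unit_iff
    (d : ℤ) (hd : 0 < d) (hsf : Squarefree d) (hd4 : d % 4 = 2 ∨ d % 4 = 3)
    (K : Type) [Field K] [NumberField K]
    (rd : 𝓞 K) (hrd : rd ^ 2 = -(d : 𝓞 K))
    (hgen : Algebra.adjoin ℚ {(rd : K)} = ⊤)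
    (p m : ℤ) :
    (IsUnit (⟨(p : 𝓞 K), (m : 𝓞 K) * rd, 0, 0⟩ : ℍ[𝓞 K]) ↔
        IsUnit (⟨p, m⟩ : ℤ√d)) ∧
      (IsUnit (⟨(p : 𝓞 K), (m : 𝓞 K) * rd, 0, 0⟩ : ℍ[𝓞 K]) ↔
        p ^ 2 - d * m ^ 2 = 1 ∨ p ^ 2 - d * m ^ 2 = -1) := by
  have hnorm : normSq (⟨(p : 𝓞 K), (m : 𝓞 K) * rd, 0, 0⟩ : ℍ[𝓞 K]) =
      ((p ^ 2 - d * m ^ 2 : ℤ) : 𝓞 K) := by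
    refine (normSq_def' _).trans ?_
    push_cast
    linear_combination (m : 𝓞 K) ^ 2 * hrd
  have hquat : IsUnit (⟨(p : 𝓞 K), (m : 𝓞 K) * rd, 0, 0⟩ : ℍ[𝓞 K]) ↔
      IsUnit (p ^ 2 - d * m ^ 2) := by
    refine (Quaternion.isUnit_iff_isUnit_normSq _).trans ?_
    exact hnorm ▸ RingOfIntegers.isUnit_intCast_iff K _
  have hpell : IsUnit (⟨p, m⟩ : ℤ√d) ↔ IsUnit (p ^ 2 - d * m ^ 2) := by
    rw [Zsqrtd.isUnit_iff_norm_isUnit, Zsqrtd.norm_def]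
    ring_nf
  exact ⟨hquat.trans hpell.symm, hquat.trans Int.isUnit_iff⟩
end

section
/- (Pell units, even case.) Let d be a positive square-free integer with d ≡ 7 (mod 8) (so that ℍ(K) is a division ring), K = ℚ(√−d), R = 𝓞_K, and let x, y be rational integers with x + y√d a unit of ℤ[√d] (i.e., x² − d y² = ±1) and with y even. Then x is odd, and for either choice of sign the element u = (y/2)√−d + ((y/2)√−d)·i + ((1 ± x)/2)·j + ((1 ∓ x)/2)·k lies in ℍ(R) and is a unit of ℍ(R) of norm η(u) = 1. -/
open Quaternion NumberField

/-- A quaternion of norm one over a commutative ring is a unit. -/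
theorem Quaternion.isUnit_of_normSq_eq_one {R : Type*} [CommRing R] {q : ℍ[R]}
    (h : Quaternion.normSq q = 1) : IsUnit q :=
  ⟨⟨q, star q, by rw [Quaternion.self_mul_star, h, Quaternion.coe_one],
    by rw [Quaternion.star_mul_self, h, Quaternion.coe_one]⟩, rfl⟩

/-- The norm of `b√−d + b√−d·i + m·j + n·k`. -/
theorem Quaternion.normSq_mk_of_sq_eq_neg {R : Type*} [CommRing R] {d b m n : ℤ} {r : R}
    (hr : r ^ 2 = -(d : R)) (h : m ^ 2 + n ^ 2 - 2 * d * b ^ 2 = 1) :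
    Quaternion.normSq (⟨(b : R) * r, (b : R) * r, (m : R), (n : R)⟩ : ℍ[R]) = 1 := by
  have h' : (m : R) ^ 2 + n ^ 2 - 2 * d * b ^ 2 = 1 := by
    exact_mod_cast congrArg (Int.cast : ℤ → R) h
  refine (Quaternion.normSq_def' _).trans ?_
  linear_combination h' + 2 * (b : R) ^ 2 * hr

/-- **Pell units, even case.** Let `d > 0` be square-free with
`d ≡ 7 (mod 8)`, `K = ℚ(√−d)`, `R = 𝓞 K`, and let `x, y ∈ ℤ` with `x + y√d` a unit of
`ℤ[√d]` (i.e. `x² − d·y² = ±1`) and `y` even. Then `x` is odd, and for either choice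
of sign the element `u = (y/2)√−d + ((y/2)√−d)·i + ((1 ± x)/2)·j + ((1 ∓ x)/2)·k`
lies in `ℍ(R)` and is a unit of `ℍ(R)` of norm `η(u) = 1`. -/
theorem pell_units_even_case
    (d : ℤ) (hd : 0 < d) (hsf : Squarefree d) (hd7 : d % 8 = 7)
    (K : Type) [Field K] [NumberField K]
    (rd : 𝓞 K) (hrd : rd ^ 2 = -(d : 𝓞 K))
    (hgen : Algebra.adjoin ℚ {(rd : K)} = ⊤)
    (x y : ℤ) (hpell : x ^ 2 - d * y ^ 2 = 1 ∨ x ^ 2 - d * y ^ 2 = -1)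
    (hy : Even y) :
    Odd x ∧
      (IsUnit (⟨((y / 2 : ℤ) : 𝓞 K) * rd, ((y / 2 : ℤ) : 𝓞 K) * rd,
          (((1 + x) / 2 : ℤ) : 𝓞 K), (((1 - x) / 2 : ℤ) : 𝓞 K)⟩ : ℍ[𝓞 K]) ∧
        Quaternion.normSq (⟨((y / 2 : ℤ) : 𝓞 K) * rd, ((y / 2 : ℤ) : 𝓞 K) * rd,
          (((1 + x) / 2 : ℤ) : 𝓞 K), (((1 - x) / 2 : ℤ) : 𝓞 K)⟩ : ℍ[𝓞 K]) = 1) ∧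
      (IsUnit (⟨((y / 2 : ℤ) : 𝓞 K) * rd, ((y / 2 : ℤ) : 𝓞 K) * rd,
          (((1 - x) / 2 : ℤ) : 𝓞 K), (((1 + x) / 2 : ℤ) : 𝓞 K)⟩ : ℍ[𝓞 K]) ∧
        Quaternion.normSq (⟨((y / 2 : ℤ) : 𝓞 K) * rd, ((y / 2 : ℤ) : 𝓞 K) * rd,
          (((1 - x) / 2 : ℤ) : 𝓞 K), (((1 + x) / 2 : ℤ) : 𝓞 K)⟩ : ℍ[𝓞 K]) = 1) := by
  obtain ⟨b, rfl⟩ := hy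
  have hx : Odd x := by
    have hev : Even (d * (b + b) ^ 2) := ⟨d * (2 * b ^ 2), by ring⟩
    have : Odd (x ^ 2) := by
      rcases hpell with h | h
      · exact (sub_add_cancel (x ^ 2) _) ▸ (h ▸ odd_one).add_even hev
      · exact (sub_add_cancel (x ^ 2) _) ▸ (h ▸ odd_neg_one).add_even hev
    exact (Int.odd_pow' two_ne_zero).1 this
  refine ⟨hx, ?_⟩
  obtain ⟨a, rfl⟩ := hx
  have hb : (b + b) / 2 = b := by lia
  have hp : (1 + (2 * a + 1)) / 2 = a + 1 := by lia
  have hm : (1 - (2 * a + 1)) / 2 = -a := by lia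
  have key : a ^ 2 + a = d * b ^ 2 := by
    rcases hpell with h | h
    · linarith
    · have : 2 * (2 * (d * b ^ 2 - a ^ 2 - a)) = 2 := by linarith
      lia
  rw [hb, hp, hm]
  have h₁ := Quaternion.normSq_mk_of_sq_eq_neg (b := b) (m := a + 1) (n := -a) hrd
    (by linear_combination 2 * key)
  have h₂ := Quaternion.normSq_mk_of_sq_eq_neg (b := b) (m := -a) (n := a + 1) hrd
    (by linear_combination 2 * key)
  exact ⟨⟨Quaternion.isUnit_of_normSq_eq_one h₁, h₁⟩,
    ⟨Quaternion.isUnit_of_normSq_eq_one h₂, h₂⟩⟩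
end

section
/- (Pell units, odd case.) Let d be a positive square-free integer with d ≡ 7 (mod 8) (so that ℍ(K) is a division ring), K = ℚ(√−d), R = 𝓞_K, and let x, y be rational integers with x + y√d a unit of ℤ[√d] (i.e., x² − d y² = ±1) and with y odd. Then x is even, x² + d y² is odd, and for either choice of sign the element u = xy√−d + (xy√−d)·i + ((1 ± (x² + d y²))/2)·j + ((1 ∓ (x² + d y²))/2)·k lies in ℍ(R) and is a unit of ℍ(R) of norm η(u) = 1. -/
open Quaternion NumberField

theorem even_and_odd_of_pell {d x y : ℤ} (hd : Odd d)
    (hpell : x ^ 2 - d * y ^ 2 = 1 ∨ x ^ 2 - d * y ^ 2 = -1) (hy : Odd y) :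
    Even x ∧ Odd (x ^ 2 + d * y ^ 2) := by
  have hdy : Odd (d * y ^ 2) := hd.mul hy.pow
  have hx2 : Even (x ^ 2) := by
    rcases hpell with h | h
    · rw [show x ^ 2 = d * y ^ 2 + 1 by linarith]
      exact hdy.add_odd odd_one
    · rw [show x ^ 2 = d * y ^ 2 - 1 by linarith]
      exact hdy.sub_odd odd_one
  exact ⟨(Int.even_pow.mp hx2).1, hx2.add_odd hdy⟩

theorem normSq_pell_eq_one {R : Type*} [CommRing R] {d x y a b : ℤ} {r : R}
    (hr : r ^ 2 = -(d : R)) (hab : a + b = 1) (hprod : a * b = -(d * x ^ 2 * y ^ 2)) :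
    Quaternion.normSq (⟨((x * y : ℤ) : R) * r, ((x * y : ℤ) : R) * r, (a : R), (b : R)⟩ :
      ℍ[R]) = 1 := by
  have hab' : (a : R) + b = 1 := by exact_mod_cast congrArg (Int.cast : ℤ → R) hab
  have hprod' : (a : R) * b = -(d * x ^ 2 * y ^ 2) := by
    exact_mod_cast congrArg (Int.cast : ℤ → R) hprod
  refine (Quaternion.normSq_def' _).trans ?_
  push_cast
  linear_combination 2 * (x : R) ^ 2 * y ^ 2 * hr + (a + b + 1) * hab' - 2 * hprod'

/-- **Pell units, odd case.** Let `d > 0` be square-free with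
`d ≡ 7 (mod 8)`, `K = ℚ(√−d)`, `R = 𝓞 K`, and let `x, y ∈ ℤ` with `x + y√d` a unit of
`ℤ[√d]` (i.e. `x² − d·y² = ±1`) and `y` odd. Then `x` is even, `x² + d·y²` is odd, and
for either choice of sign the element
`u = xy√−d + (xy√−d)·i + ((1 ± (x² + d·y²))/2)·j + ((1 ∓ (x² + d·y²))/2)·k`
lies in `ℍ(R)` and is a unit of `ℍ(R)` of norm `η(u) = 1`. -/
theorem pell_units_odd_case
    (d : ℤ) (hd : 0 < d) (hsf : Squarefree d) (hd7 : d % 8 = 7)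
    (K : Type) [Field K] [NumberField K]
    (rd : 𝓞 K) (hrd : rd ^ 2 = -(d : 𝓞 K))
    (hgen : Algebra.adjoin ℚ {(rd : K)} = ⊤)
    (x y : ℤ) (hpell : x ^ 2 - d * y ^ 2 = 1 ∨ x ^ 2 - d * y ^ 2 = -1)
    (hy : Odd y) :
    Even x ∧ Odd (x ^ 2 + d * y ^ 2) ∧
      (IsUnit (⟨((x * y : ℤ) : 𝓞 K) * rd, ((x * y : ℤ) : 𝓞 K) * rd,
          (((1 + (x ^ 2 + d * y ^ 2)) / 2 : ℤ) : 𝓞 K),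
          (((1 - (x ^ 2 + d * y ^ 2)) / 2 : ℤ) : 𝓞 K)⟩ : ℍ[𝓞 K]) ∧
        Quaternion.normSq (⟨((x * y : ℤ) : 𝓞 K) * rd, ((x * y : ℤ) : 𝓞 K) * rd,
          (((1 + (x ^ 2 + d * y ^ 2)) / 2 : ℤ) : 𝓞 K),
          (((1 - (x ^ 2 + d * y ^ 2)) / 2 : ℤ) : 𝓞 K)⟩ : ℍ[𝓞 K]) = 1) ∧
      (IsUnit (⟨((x * y : ℤ) : 𝓞 K) * rd, ((x * y : ℤ) : 𝓞 K) * rd,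
          (((1 - (x ^ 2 + d * y ^ 2)) / 2 : ℤ) : 𝓞 K),
          (((1 + (x ^ 2 + d * y ^ 2)) / 2 : ℤ) : 𝓞 K)⟩ : ℍ[𝓞 K]) ∧
        Quaternion.normSq (⟨((x * y : ℤ) : 𝓞 K) * rd, ((x * y : ℤ) : 𝓞 K) * rd,
          (((1 - (x ^ 2 + d * y ^ 2)) / 2 : ℤ) : 𝓞 K),
          (((1 + (x ^ 2 + d * y ^ 2)) / 2 : ℤ) : 𝓞 K)⟩ : ℍ[𝓞 K]) = 1) := by
  obtain ⟨hx, hs⟩ := even_and_odd_of_pell (Int.odd_iff.mpr (by omega)) hpell hy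
  refine ⟨hx, hs, ?_⟩
  have hsq : (x ^ 2 + d * y ^ 2) ^ 2 = 1 + 4 * (d * x ^ 2 * y ^ 2) := by
    have h : (x ^ 2 - d * y ^ 2) ^ 2 = 1 := by rcases hpell with h | h <;> rw [h] <;> norm_num
    linear_combination h
  obtain ⟨m, hm⟩ := hs
  rw [hm] at hsq ⊢
  have ha : (1 + (2 * m + 1)) / 2 = m + 1 := by omega
  have hb : (1 - (2 * m + 1)) / 2 = -m := by omega
  rw [ha, hb]
  have h₁ := normSq_pell_eq_one (x := x) (y := y) (a := m + 1) (b := -m) hrd (by ring)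
    (by linarith)
  have h₂ := normSq_pell_eq_one (x := x) (y := y) (a := -m) (b := m + 1) hrd (by ring)
    (by linarith)
  exact ⟨⟨Quaternion.isUnit_of_normSq_eq_one h₁, h₁⟩,
    ⟨Quaternion.isUnit_of_normSq_eq_one h₂, h₂⟩⟩
end

section
/- (Gauss units.) Let d be a positive square-free integer with d ≡ 7 (mod 8) (so that ℍ(K) is a division ring), K = ℚ(√−d), R = 𝓞_K, and let m be a rational integer with m ≡ 2 (mod 4). Then there exist rational integers p, q, r such that u = m√−d + p·i + q·j + r·k is a unit of ℍ(R). -/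
open Quaternion NumberField

/-- The symmetric integer matrix with rows `(a, b, c)`, `(b, d, e)`, `(c, e, f)` is the Gram
matrix of three vectors of `ℤ³`. -/
def IsIntGram (a b c d e f : ℤ) : Prop :=
  ∃ u v w : Fin 3 → ℤ, u ⬝ᵥ u = a ∧ u ⬝ᵥ v = b ∧ u ⬝ᵥ w = c ∧ v ⬝ᵥ v = d ∧ v ⬝ᵥ w = e ∧ w ⬝ᵥ w = f

namespace IsIntGram

theorem swap_fst_snd {a b c d e f : ℤ} (h : IsIntGram d b e a c f) : IsIntGram a b c d e f := by
  obtain ⟨u, v, w, h1, h2, h3, h4, h5, h6⟩ := h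
  exact ⟨v, u, w, h4, by rw [dotProduct_comm, h2], h5, h1, h3, h6⟩

theorem swap_snd_trd {a b c d e f : ℤ} (h : IsIntGram a c b f e d) : IsIntGram a b c d e f := by
  obtain ⟨u, v, w, h1, h2, h3, h4, h5, h6⟩ := h
  exact ⟨u, w, v, h1, h3, h2, h6, by rw [dotProduct_comm, h5], h4⟩

theorem of_add_mul_fst {a b c d e f : ℤ} (k : ℤ)
    (h : IsIntGram a (b + k * a) c (d + 2 * k * b + k ^ 2 * a) (e + k * c) f) :
    IsIntGram a b c d e f := by
  obtain ⟨u, v, w, h1, h2, h3, h4, h5, h6⟩ := h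
  refine ⟨u, v - k • u, w, h1, ?_, h3, ?_, ?_, h6⟩
  · simp only [dotProduct_sub, dotProduct_smul, smul_eq_mul, h1, h2]; ring
  · simp only [dotProduct_sub, sub_dotProduct, smul_dotProduct, dotProduct_smul, smul_eq_mul,
      dotProduct_comm v u, h1, h2, h4]; ring
  · simp only [sub_dotProduct, smul_dotProduct, smul_eq_mul, h3, h5]; ring

theorem of_add_mul_snd {a b c d e f : ℤ} (k : ℤ)
    (h : IsIntGram a b (c + k * b) d (e + k * d) (f + 2 * k * e + k ^ 2 * d)) :
    IsIntGram a b c d e f := by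
  obtain ⟨u, v, w, h1, h2, h3, h4, h5, h6⟩ := h
  refine ⟨u, v, w - k • v, h1, h2, ?_, h4, ?_, ?_⟩
  · simp only [dotProduct_sub, dotProduct_smul, smul_eq_mul, h2, h3]; ring
  · simp only [dotProduct_sub, dotProduct_smul, smul_eq_mul, h4, h5]; ring
  · simp only [dotProduct_sub, sub_dotProduct, smul_dotProduct, dotProduct_smul, smul_eq_mul,
      dotProduct_comm w v, h4, h5, h6]; ring

end IsIntGram

theorem exists_two_mul_abs_add_mul_le (b : ℤ) {a : ℤ} (ha : 0 < a) :
    ∃ k : ℤ, 2 * |b + k * a| ≤ a := by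
  refine ⟨-((2 * b + a) / (2 * a)), ?_⟩
  have h1 := Int.emod_add_mul_ediv (2 * b + a) (2 * a)
  have h2 := Int.emod_nonneg (2 * b + a) (b := 2 * a) (by omega)
  have h3 := Int.emod_lt_of_pos (2 * b + a) (b := 2 * a) (by omega)
  have : |2 * (b + -((2 * b + a) / (2 * a)) * a)| ≤ a := abs_le.2 ⟨by nlinarith, by nlinarith⟩
  rwa [abs_mul, abs_two] at this

/-- A reduced positive definite ternary form of determinant one is a sum of three squares. -/
theorem isIntGram_of_reduced {a b c d e f : ℤ} (ha : 0 < a) (hP : 0 < a * d - b ^ 2)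
    (hdet : (a * d - b ^ 2) * (a * f - c ^ 2) - (a * e - b * c) ^ 2 = a)
    (hb : 2 * |b| ≤ a) (hQ : 2 * |a * e - b * c| ≤ a * d - b ^ 2) (had : a ≤ d)
    (hPR : a * d - b ^ 2 ≤ a * f - c ^ 2) : IsIntGram a b c d e f := by
  have hb2 : 4 * b ^ 2 ≤ a ^ 2 := by nlinarith [sq_abs b, abs_nonneg b]
  have hQ2 : 4 * (a * e - b * c) ^ 2 ≤ (a * d - b ^ 2) ^ 2 := by
    nlinarith [sq_abs (a * e - b * c), abs_nonneg (a * e - b * c)]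
  have h1 : 3 * (a * d - b ^ 2) ^ 2 ≤ 4 * a := by nlinarith
  have h2 : 3 * a ^ 2 ≤ 4 * (a * d - b ^ 2) := by nlinarith
  have ha1 : a = 1 := by
    by_contra hne
    have : 2 ≤ a := by omega
    generalize a * d - b ^ 2 = P at *
    nlinarith
  subst ha1
  have hb0 : b = 0 := abs_eq_zero.1 (by have := abs_nonneg b; omega)
  subst hb0
  have hd1 : d = 1 := by
    have : 3 * d ^ 2 ≤ 4 := by linarith
    nlinarith
  subst hd1
  have he0 : e = 0 := by
    have h := abs_nonneg e
    refine abs_eq_zero.1 ?_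
    simp only [one_mul, zero_mul, sub_zero] at hQ
    omega
  subst he0
  have hf : f = 1 + c ^ 2 := by linarith
  subst hf
  refine ⟨![1, 0, 0], ![0, 1, 0], ![c, 0, 1], ?_⟩
  simp [dotProduct, Fin.sum_univ_three]
  ring

/-- Every positive definite integral ternary form of determinant one is equivalent to a sum of
three squares. -/
theorem isIntGram_of_det_eq_one : ∀ (a b c d e f : ℤ), 0 < a → 0 < a * d - b ^ 2 →
    a * (d * f - e ^ 2) - b * (b * f - c * e) + c * (b * e - c * d) = 1 →
    IsIntGram a b c d e f := by
  suffices H : ∀ A P : ℕ, ∀ a b c d e f : ℤ, a = A → a * d - b ^ 2 = P → 0 < a →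
      0 < a * d - b ^ 2 →
      a * (d * f - e ^ 2) - b * (b * f - c * e) + c * (b * e - c * d) = 1 →
      IsIntGram a b c d e f by
    intro a b c d e f ha hP
    exact H a.toNat (a * d - b ^ 2).toNat a b c d e f (by omega) (by omega) ha hP
  intro A
  induction A using Nat.strong_induction_on with
  | _ A ihA =>
  intro P
  induction P using Nat.strong_induction_on with
  | _ P ihP =>
  intro a b c d e f hA hP ha hP0 hdet
  obtain ⟨k, hk⟩ := exists_two_mul_abs_add_mul_le b ha
  refine IsIntGram.of_add_mul_fst k ?_
  replace hP : a * (d + 2 * k * b + k ^ 2 * a) - (b + k * a) ^ 2 = P := by linarith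
  replace hP0 : 0 < a * (d + 2 * k * b + k ^ 2 * a) - (b + k * a) ^ 2 := by linarith
  replace hdet : a * ((d + 2 * k * b + k ^ 2 * a) * f - (e + k * c) ^ 2)
      - (b + k * a) * ((b + k * a) * f - c * (e + k * c))
      + c * ((b + k * a) * (e + k * c) - c * (d + 2 * k * b + k ^ 2 * a)) = 1 := by
    linarith
  generalize b + k * a = b at *
  generalize d + 2 * k * _ + k ^ 2 * a = d at *
  generalize e + k * c = e at *
  obtain ⟨l, hl⟩ := exists_two_mul_abs_add_mul_le (a * e - b * c) hP0
  refine IsIntGram.of_add_mul_snd l ?_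
  replace hl : 2 * |a * (e + l * d) - b * (c + l * b)| ≤ a * d - b ^ 2 := by
    convert hl using 3; ring
  replace hdet : a * (d * (f + 2 * l * e + l ^ 2 * d) - (e + l * d) ^ 2)
      - b * (b * (f + 2 * l * e + l ^ 2 * d) - (c + l * b) * (e + l * d))
      + (c + l * b) * (b * (e + l * d) - (c + l * b) * d) = 1 := by
    linarith
  generalize c + l * b = c at *
  generalize f + 2 * l * _ + l ^ 2 * d = f at *
  generalize e + l * d = e at *
  have hdet' : (a * d - b ^ 2) * (a * f - c ^ 2) - (a * e - b * c) ^ 2 = a := by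
    linear_combination a * hdet
  rcases lt_or_ge d a with hda | had
  · have hd0 : 0 < d := by
      have : 0 < a * d := by nlinarith [sq_nonneg b]
      exact pos_of_mul_pos_right this ha.le
    refine IsIntGram.swap_fst_snd (ihA d.toNat (by omega) P d b e a c f (by omega) ?_ hd0 ?_ ?_)
    · linarith
    · linarith
    · linarith
  rcases lt_or_ge (a * f - c ^ 2) (a * d - b ^ 2) with hRP | hPR
  · have hR0 : 0 < a * f - c ^ 2 := by
      have : 0 < (a * d - b ^ 2) * (a * f - c ^ 2) := by nlinarith [sq_nonneg (a * e - b * c)]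
      exact pos_of_mul_pos_right this hP0.le
    refine IsIntGram.swap_snd_trd
      (ihP (a * f - c ^ 2).toNat (by omega) a c b f e d hA (by omega) ha hR0 ?_)
    linarith
  exact isIntGram_of_reduced ha hP0 hdet' hk hl had hPR

open NumberTheorySymbols in
/-- For `n ≡ 3 (mod 8)` there is `D > 0` such that `-D` is a square modulo `D n - 1`. -/
theorem exists_dvd_sq_add_of_mod_eight_eq_three {n : ℕ} (hn : n % 8 = 3) :
    ∃ D s : ℤ, 0 < D ∧ 0 < D * n - 1 ∧ D * n - 1 ∣ s ^ 2 + D := by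
  obtain ⟨k, rfl⟩ : ∃ k, n = 8 * k + 3 := ⟨n / 8, by omega⟩
  have hcop : Nat.Coprime (4 * k + 1) (4 * (8 * k + 3)) := by
    refine Nat.Coprime.mul_right ?_ ?_
    · have : Nat.Coprime (1 + k * 4) 4 := by simp
      rwa [add_comm, mul_comm] at this
    · have : Nat.Coprime (4 * k + 1) (1 + 2 * (4 * k + 1)) := by simp
      convert this using 1; ring
  obtain ⟨p, -, hp, hpm⟩ := Nat.forall_exists_prime_gt_and_eq_mod
    ((ZMod.isUnit_iff_coprime _ _).2 hcop) 0
  rw [ZMod.natCast_eq_natCast_iff'] at hpm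
  rw [Nat.mod_eq_of_lt (by omega : 4 * k + 1 < 4 * (8 * k + 3))] at hpm
  obtain ⟨j, hj⟩ : ∃ j, p = 4 * (8 * k + 3) * j + (4 * k + 1) :=
    ⟨p / (4 * (8 * k + 3)), by rw [← hpm]; exact (Nat.div_add_mod _ _).symm⟩
  have h2p : 2 * p + 1 = (8 * j + 1) * (8 * k + 3) := by rw [hj]; ring
  have hp4 : p % 4 = 1 := by rw [hj, mul_assoc]; omega
  have hpodd : Odd p := Nat.odd_iff.2 (by omega)
  have hDodd : Odd (8 * j + 1) := Nat.odd_iff.2 (by omega)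
  have : Fact p.Prime := ⟨hp⟩
  have hJ : J(-((8 * j + 1 : ℕ) : ℤ) | p) = 1 := by
    have e1 : J(((2 * p : ℕ) : ℤ) | 8 * j + 1) = J(-1 | 8 * j + 1) := by
      refine jacobiSym.mod_left' (Int.ModEq.symm (Int.modEq_iff_dvd.2 ⟨(8 * k + 3 : ℕ), ?_⟩))
      rw [sub_neg_eq_add]
      exact_mod_cast h2p
    have e2 : J(-1 | 8 * j + 1) = 1 := by
      rw [jacobiSym.at_neg_one hDodd, ZMod.χ₄_nat_one_mod_four (by omega)]
    have e3 : J(2 | 8 * j + 1) = 1 := by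
      rw [jacobiSym.at_two hDodd, ZMod.χ₈_nat_eq_if_mod_eight, if_neg (by omega),
        if_pos (by omega)]
    rw [e2] at e1
    push_cast at e1
    rw [jacobiSym.mul_left, e3, one_mul] at e1
    rw [neg_eq_neg_one_mul, jacobiSym.mul_left, jacobiSym.at_neg_one hpodd,
      ZMod.χ₄_nat_one_mod_four hp4, one_mul,
      jacobiSym.quadratic_reciprocity_one_mod_four (by omega) hpodd, e1]
  have hsq : ∃ x : ℤ, (p : ℤ) ∣ x ^ 2 + ((8 * j + 1 : ℕ) : ℤ) := by
    obtain ⟨y, hy⟩ := ZMod.isSquare_of_jacobiSym_eq_one hJ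
    obtain ⟨x, rfl⟩ := ZMod.intCast_surjective y
    refine ⟨x, (ZMod.intCast_zmod_eq_zero_iff_dvd _ p).1 ?_⟩
    push_cast at hy ⊢
    linear_combination -hy
  obtain ⟨s, hs, hs2⟩ : ∃ s : ℤ, (p : ℤ) ∣ s ^ 2 + ((8 * j + 1 : ℕ) : ℤ) ∧ s % 2 = 1 := by
    obtain ⟨x, hx⟩ := hsq
    rcases Int.emod_two_eq_zero_or_one x with h | h
    · refine ⟨x + p, ?_, by omega⟩
      have : (x + p) ^ 2 + ((8 * j + 1 : ℕ) : ℤ)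
          = x ^ 2 + ((8 * j + 1 : ℕ) : ℤ) + p * (2 * x + p) := by ring
      rw [this]
      exact dvd_add hx (dvd_mul_right _ _)
    · exact ⟨x, hx, h⟩
  have hN : ((8 * j + 1 : ℕ) : ℤ) * ((8 * k + 3 : ℕ) : ℤ) - 1 = 2 * p := by
    have := congrArg (Nat.cast : ℕ → ℤ) h2p
    push_cast at this ⊢
    linarith
  refine ⟨(8 * j + 1 : ℕ), s, by positivity, ?_, ?_⟩
  · rw [hN]; have := hp.pos; positivity
  · rw [hN]
    refine IsCoprime.mul_dvd ?_ ?_ hs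
    · rw [Int.isCoprime_iff_gcd_eq_one]
      exact (Nat.coprime_two_left).2 hpodd
    · have : (s ^ 2) % 2 = 1 := by rw [pow_two, Int.mul_emod, hs2]; rfl
      omega

/-- A natural number congruent to `3` modulo `8` is a sum of three squares. -/
theorem sum_three_sq_of_mod_eight_eq_three {n : ℕ} (hn : n % 8 = 3) :
    ∃ x y z : ℤ, x ^ 2 + y ^ 2 + z ^ 2 = n := by
  obtain ⟨D, s, hD, hN, t, ht⟩ := exists_dvd_sq_add_of_mod_eight_eq_three hn
  have ht0 : 0 < t := by
    have : 0 < (D * n - 1) * t := by rw [← ht]; positivity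
    exact pos_of_mul_pos_right this hN.le
  obtain ⟨-, -, w, -, -, -, -, -, hw⟩ := isIntGram_of_det_eq_one t s 1 (D * n - 1) 0 n ht0
    (by linarith) (by linear_combination (-n : ℤ) * ht)
  refine ⟨w 0, w 1, w 2, ?_⟩
  rw [← hw, dotProduct, Fin.sum_univ_three]
  ring

/-- **Gauss units.** Let `d > 0` be square-free with `d ≡ 7 (mod 8)`,
`K = ℚ(√−d)`, `R = 𝓞 K`, and let `m` be a rational integer with `m ≡ 2 (mod 4)`. Then
there exist rational integers `p, q, r` such that `u = m√−d + p·i + q·j + r·k` is a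
unit of `ℍ(R)`. -/
theorem gauss_units_exist
    (d : ℤ) (hd : 0 < d) (hsf : Squarefree d) (hd7 : d % 8 = 7)
    (K : Type) [Field K] [NumberField K]
    (rd : 𝓞 K) (hrd : rd ^ 2 = -(d : 𝓞 K))
    (hgen : Algebra.adjoin ℚ {(rd : K)} = ⊤)
    (m : ℤ) (hm : m % 4 = 2) :
    ∃ p q r : ℤ,
      IsUnit (⟨(m : 𝓞 K) * rd, (p : 𝓞 K), (q : 𝓞 K), (r : 𝓞 K)⟩ : ℍ[𝓞 K]) := by
  obtain ⟨n, hn, hn8⟩ : ∃ n : ℕ, (n : ℤ) = d * m ^ 2 - 1 ∧ n % 8 = 3 := by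
    obtain ⟨k, rfl⟩ : ∃ k, m = 4 * k + 2 := ⟨m / 4, by omega⟩
    obtain ⟨l, hl⟩ : ∃ l, d = 8 * l + 7 := ⟨d / 8, by omega⟩
    have h8 : (d * (4 * k + 2) ^ 2 - 1) % 8 = 3 := by
      have : d * (4 * k + 2) ^ 2 - 1 = 8 * (d * (2 * k ^ 2 + 2 * k) + 4 * l + 3) + 3 := by
        rw [hl]; ring
      omega
    have h0 : 0 ≤ d * (4 * k + 2) ^ 2 := by positivity
    exact ⟨(d * (4 * k + 2) ^ 2 - 1).toNat, by omega, by omega⟩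
  obtain ⟨p, q, r, hpqr⟩ := sum_three_sq_of_mod_eight_eq_three hn8
  refine ⟨p, q, r, ?_⟩
  have hnorm : ((m : 𝓞 K) * rd) ^ 2 + (p : 𝓞 K) ^ 2 + (q : 𝓞 K) ^ 2 + (r : 𝓞 K) ^ 2 = -1 := by
    have h : ((p ^ 2 + q ^ 2 + r ^ 2 : ℤ) : 𝓞 K) = ((d * m ^ 2 - 1 : ℤ) : 𝓞 K) := by
      rw [hpqr, hn]
    push_cast at h
    linear_combination h + (m : 𝓞 K) ^ 2 * hrd
  set u : ℍ[𝓞 K] := ⟨(m : 𝓞 K) * rd, (p : 𝓞 K), (q : 𝓞 K), (r : 𝓞 K)⟩ with hu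
  have hns : Quaternion.normSq u = -1 := by
    rw [Quaternion.normSq_def', hu]
    exact hnorm
  have h1 : u * -star u = 1 := by rw [mul_neg, Quaternion.self_mul_star, hns]; simp
  have h2 : -star u * u = 1 := by rw [neg_mul, Quaternion.star_mul_self, hns]; simp
  exact ⟨⟨u, -star u, h1, h2⟩, rfl⟩
end

section
/- Let d be a positive square-free integer with d ≡ 7 (mod 8), K = ℚ(√−d), R = 𝓞_K. Let a, b, p, q be rational integers with a ≠ 0 and b ≠ 0, and suppose u = a√−d + p·i and v = b√−d + q·j are units of ℍ(R) (Gauss 2-units with supp(u) ∩ supp(v) = {1}). Then there exists a positive integer m such that the subgroup ⟨uᵐ, vᵐ⟩ of the unit group of ℍ(R) is a free group of rank two, i.e., the group homomorphism from the free group on two generators to ℍ(R)ˣ sending the generators to uᵐ and vᵐ is injective. -/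
open Quaternion NumberField

/-- Two elements of a group that stretch the coordinate pairs `(x, y)` and `(z, w)` respectively,
by factors with ratio larger than `9`, play ping-pong, provided that the pairs are related by the
triangle inequalities satisfied by `|z| = |x + y|` and `|w| = |x - y|`. -/
lemma FreeGroup.injective_lift_of_stretching {G : Type} [Group G] {U V : G}
    {x y z w : G → ℝ} {α β γ δ : ℝ}
    (hx : ∀ g, 0 ≤ x g) (hy : ∀ g, 0 ≤ y g) (hz : ∀ g, 0 ≤ z g) (hw : ∀ g, 0 ≤ w g)
    (hxy : ∀ g, 0 < x g + y g)
    (hzxy : ∀ g, z g ≤ x g + y g) (hwxy : ∀ g, w g ≤ x g + y g)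
    (hxzw : ∀ g, 2 * x g ≤ z g + w g) (hyzw : ∀ g, 2 * y g ≤ z g + w g)
    (hUx : ∀ g, x (U * g) = α * x g) (hUy : ∀ g, y (U * g) = β * y g)
    (hVz : ∀ g, z (V * g) = γ * z g) (hVw : ∀ g, w (V * g) = δ * w g)
    (hβ : 0 ≤ β) (hδ : 0 ≤ δ) (hαβ : 9 * β < α) (hγδ : 9 * δ < γ) :
    Function.Injective (FreeGroup.lift (fun i : Bool => if i then U else V)) := by
  have hU : ∀ g, y g ≤ 3 * x g → 3 * y (U * g) < x (U * g) := by
    intro g hg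
    have hxg : 0 < x g := by linarith [hx g, hxy g]
    rw [hUx, hUy]
    nlinarith [mul_le_mul_of_nonneg_left hg hβ, mul_lt_mul_of_pos_right hαβ hxg]
  have hV : ∀ g, w g ≤ 3 * z g → 3 * w (V * g) < z (V * g) := by
    intro g hg
    have hzg : 0 < z g := by linarith [hz g, hxy g, hxzw g, hyzw g]
    rw [hVz, hVw]
    nlinarith [mul_le_mul_of_nonneg_left hg hδ, mul_lt_mul_of_pos_right hγδ hzg]
  let X : Bool → Set G := fun i => if i then {g | 3 * y g < x g} else {g | 3 * w g < z g}
  let Y : Bool → Set G := fun i => if i then {g | 3 * x g < y g} else {g | 3 * z g < w g}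
  refine FreeGroup.injective_lift_of_ping_pong (α := G) _ X Y ?_ ?_ ?_ ?_ ?_ ?_
  · have hne : ∃ g, 3 * y g < x g := by
      by_cases h : y 1 ≤ 3 * x 1
      · exact ⟨_, hU _ h⟩
      · refine ⟨_, hU _ (?_ : y (V * 1) ≤ _)⟩
        have := hV 1 (by linarith [hx 1, hwxy 1, hyzw 1])
        linarith [hx (V * 1), hzxy (V * 1), hwxy (V * 1), hyzw (V * 1)]
    obtain ⟨g, hg⟩ := hne
    rintro (_ | _)
    · refine ⟨V * g, ?_⟩
      simp only [X, Bool.false_eq_true, if_false, Set.mem_ofPred_eq]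
      exact hV g (by linarith [hx g, hwxy g, hxzw g])
    · exact ⟨g, by simpa [X] using hg⟩
  · rintro (_ | _) (_ | _) h <;> first
      | exact absurd rfl h
      | refine Set.disjoint_left.2 fun g h₁ h₂ => ?_
        simp only [X, Bool.false_eq_true, if_false, if_true, Set.mem_ofPred_eq] at h₁ h₂
        linarith [hx g, hw g, hzxy g, hwxy g, hxzw g, hyzw g]
  · rintro (_ | _) (_ | _) h <;> first
      | exact absurd rfl h
      | refine Set.disjoint_left.2 fun g h₁ h₂ => ?_
        simp only [Y, Bool.false_eq_true, if_false, if_true, Set.mem_ofPred_eq] at h₁ h₂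
        linarith [hx g, hz g, hzxy g, hwxy g, hxzw g, hyzw g]
  · rintro (_ | _) (_ | _) <;>
    · refine Set.disjoint_left.2 fun g h₁ h₂ => ?_
      simp only [X, Y, Bool.false_eq_true, if_false, if_true, Set.mem_ofPred_eq] at h₁ h₂
      linarith [hx g, hy g, hz g, hw g, hzxy g, hwxy g, hxzw g, hyzw g]
  · rintro (_ | _) _ ⟨g, hg, rfl⟩ <;>
      simp only [X, Y, Bool.false_eq_true, if_false, if_true, Set.mem_compl_iff,
        Set.mem_ofPred_eq, not_lt, smul_eq_mul] at hg ⊢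
    · exact hV g hg
    · exact hU g hg
  · rintro (_ | _) _ ⟨g, hg, rfl⟩ <;>
      simp only [X, Y, Pi.inv_apply, Bool.false_eq_true, if_false, if_true, Set.mem_compl_iff,
        Set.mem_ofPred_eq, not_lt, smul_eq_mul] at hg ⊢
    · by_contra! h
      have := hV _ h
      rw [mul_inv_cancel_left] at this
      linarith
    · by_contra! h
      have := hU _ h
      rw [mul_inv_cancel_left] at this
      linarith

lemma exists_forall_nine_mul_pow_lt {α β : ℝ} (hβ : 0 ≤ β) (h : β < α) :
    ∃ n : ℕ, ∀ m, n ≤ m → 9 * β ^ m < α ^ m := by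
  have hα : 0 < α := hβ.trans_lt h
  obtain ⟨n, hn⟩ := exists_pow_lt_of_lt_one (show (0 : ℝ) < 1 / 9 by norm_num)
    ((div_lt_one hα).2 h)
  refine ⟨n, fun m hm => ?_⟩
  have hlt := (pow_le_pow_of_le_one (by positivity) ((div_lt_one hα).2 h).le hm).trans_lt hn
  rw [div_pow, div_lt_iff₀ (by positivity)] at hlt
  linarith

lemma apply_pow_mul_eq {G : Type*} [Monoid G] {U : G} {x : G → ℝ} {α : ℝ}
    (h : ∀ g, x (U * g) = α * x g) (n : ℕ) (g : G) : x (U ^ n * g) = α ^ n * x g := by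
  induction n with
  | zero => simp
  | succ n ih => rw [pow_succ', mul_assoc, h, ih, pow_succ', mul_assoc]

lemma FreeGroup.exists_pow_injective_lift_of_lt {G : Type} [Group G] {U V : G}
    {x y z w : G → ℝ} {α β γ δ : ℝ}
    (hx : ∀ g, 0 ≤ x g) (hy : ∀ g, 0 ≤ y g) (hz : ∀ g, 0 ≤ z g) (hw : ∀ g, 0 ≤ w g)
    (hxy : ∀ g, 0 < x g + y g)
    (hzxy : ∀ g, z g ≤ x g + y g) (hwxy : ∀ g, w g ≤ x g + y g)
    (hxzw : ∀ g, 2 * x g ≤ z g + w g) (hyzw : ∀ g, 2 * y g ≤ z g + w g)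
    (hUx : ∀ g, x (U * g) = α * x g) (hUy : ∀ g, y (U * g) = β * y g)
    (hVz : ∀ g, z (V * g) = γ * z g) (hVw : ∀ g, w (V * g) = δ * w g)
    (hβ : 0 ≤ β) (hδ : 0 ≤ δ) (hαβ : β < α) (hγδ : δ < γ) :
    ∃ m : ℕ, 0 < m ∧
      Function.Injective (FreeGroup.lift (fun i : Bool => if i then U ^ m else V ^ m)) := by
  obtain ⟨k, hk⟩ := exists_forall_nine_mul_pow_lt hβ hαβ
  obtain ⟨l, hl⟩ := exists_forall_nine_mul_pow_lt hδ hγδ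
  exact ⟨k + l + 1, by lia, injective_lift_of_stretching hx hy hz hw hxy hzxy hwxy hxzw hyzw
    (apply_pow_mul_eq hUx _) (apply_pow_mul_eq hUy _) (apply_pow_mul_eq hVz _)
    (apply_pow_mul_eq hVw _) (by positivity) (by positivity) (hk _ (by lia)) (hl _ (by lia))⟩

lemma FreeGroup.exists_pow_injective_lift_of_ne {G : Type} [Group G] {U V : G}
    {x y z w : G → ℝ} {α β γ δ : ℝ}
    (hx : ∀ g, 0 ≤ x g) (hy : ∀ g, 0 ≤ y g) (hz : ∀ g, 0 ≤ z g) (hw : ∀ g, 0 ≤ w g)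
    (hxy : ∀ g, 0 < x g + y g)
    (hzxy : ∀ g, z g ≤ x g + y g) (hwxy : ∀ g, w g ≤ x g + y g)
    (hxzw : ∀ g, 2 * x g ≤ z g + w g) (hyzw : ∀ g, 2 * y g ≤ z g + w g)
    (hUx : ∀ g, x (U * g) = α * x g) (hUy : ∀ g, y (U * g) = β * y g)
    (hVz : ∀ g, z (V * g) = γ * z g) (hVw : ∀ g, w (V * g) = δ * w g)
    (hα : 0 ≤ α) (hβ : 0 ≤ β) (hγ : 0 ≤ γ) (hδ : 0 ≤ δ) (hαβ : α ≠ β) (hγδ : γ ≠ δ) :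
    ∃ m : ℕ, 0 < m ∧
      Function.Injective (FreeGroup.lift (fun i : Bool => if i then U ^ m else V ^ m)) := by
  wlog hlt : β < α generalizing x y α β
  · exact this hy hx (fun g => by linarith [hxy g]) (fun g => by linarith [hzxy g])
      (fun g => by linarith [hwxy g]) hyzw hxzw hUy hUx hβ hα hαβ.symm
      (lt_of_le_of_ne (not_lt.1 hlt) hαβ)
  wlog hlt' : δ < γ generalizing z w γ δ
  · exact this hw hz hVw hVz hδ hγ hγδ.symm hwxy hzxy (fun g => by linarith [hxzw g])
      (fun g => by linarith [hyzw g]) (lt_of_le_of_ne (not_lt.1 hlt') hγδ)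
  exact exists_pow_injective_lift_of_lt hx hy hz hw hxy hzxy hwxy hxzw hyzw hUx hUy hVz hVw
    hβ hδ hlt hlt'

open Complex in
lemma norm_mul_add_mul_I_ne_norm_mul_sub_mul_I {d : ℤ} (hd : 0 < d) {r : ℂ} (hr : r ^ 2 = -d)
    {a p : ℤ} (ha : a ≠ 0) (hp : p ≠ 0) : ‖a * r + p * I‖ ≠ ‖a * r - p * I‖ := by
  intro h
  have hsq : normSq (a * r + p * I) = normSq (a * r - p * I) := by
    rw [normSq_eq_norm_sq, normSq_eq_norm_sq, h]
  have hre : (r ^ 2).re = -d := by simp [hr]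
  have him : (r ^ 2).im = 0 := by simp [hr]
  simp only [normSq_apply, sq, mul_re, mul_im, add_re, add_im, sub_re, sub_im, intCast_re,
    intCast_im, I_re, I_im] at hsq hre him
  have hd' : (0 : ℝ) < d := by exact_mod_cast hd
  have hr0 : r.im ≠ 0 := fun h0 => by rw [h0] at hre; nlinarith
  have hprod : (a : ℝ) * p * r.im = 0 := by linarith
  simp [ha, hp, hr0] at hprod

lemma Quaternion.isUnit_normSq {R : Type*} [CommRing R] (q : ℍ[R]ˣ) :
    IsUnit (normSq (q : ℍ[R])) := q.isUnit.map normSq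

/-- If `a² r² + p²` is a unit for an algebraic integer `r` with `r² = -d`, and `d > 1`,
then `p ≠ 0`. -/
lemma ne_zero_of_isUnit_mul_sq_add_sq {d : ℤ} (hd : 1 < d) {K : Type*} [Field K] [NumberField K]
    {r : 𝓞 K} (hr : r ^ 2 = -(d : 𝓞 K)) {a p : ℤ}
    (h : IsUnit (((a : 𝓞 K) * r) ^ 2 + (p : 𝓞 K) ^ 2)) : p ≠ 0 := by
  rintro rfl
  rw [mul_pow, hr, show (a : 𝓞 K) ^ 2 * -(d : 𝓞 K) + ((0 : ℤ) : 𝓞 K) ^ 2 =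
    algebraMap ℤ (𝓞 K) (-(a ^ 2) * d) by simp] at h
  have hu := isUnit_of_mul_isUnit_right (isUnit_of_map_unit _ _ h)
  rcases Int.isUnit_iff.1 hu with h | h <;> lia

/-- Let `d > 0` be square-free with `d ≡ 7 (mod 8)`, `K = ℚ(√−d)`,
`R = 𝓞 K`. Let `a, b, p, q ∈ ℤ` with `a ≠ 0`, `b ≠ 0`, and suppose
`u = a√−d + p·i` and `v = b√−d + q·j` are units of `ℍ(R)` (Gauss 2-units with
`supp(u) ∩ supp(v) = {1}`). Then there is a positive integer `m` such that
`⟨uᵐ, vᵐ⟩` is a free group of rank two: the homomorphism from the free group on two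
generators to `ℍ(R)ˣ` sending the generators to `uᵐ` and `vᵐ` is injective. -/
theorem gauss_two_units_free_group
    (d : ℤ) (hd : 0 < d) (hsf : Squarefree d) (hd7 : d % 8 = 7)
    (K : Type) [Field K] [NumberField K]
    (rd : 𝓞 K) (hrd : rd ^ 2 = -(d : 𝓞 K))
    (hgen : Algebra.adjoin ℚ {(rd : K)} = ⊤)
    (a b p q : ℤ) (ha : a ≠ 0) (hb : b ≠ 0)
    (U V : ℍ[𝓞 K]ˣ)
    (hU : (U : ℍ[𝓞 K]) = (⟨(a : 𝓞 K) * rd, (p : 𝓞 K), 0, 0⟩ : ℍ[𝓞 K]))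
    (hV : (V : ℍ[𝓞 K]) = (⟨(b : 𝓞 K) * rd, 0, (q : 𝓞 K), 0⟩ : ℍ[𝓞 K])) :
    ∃ m : ℕ, 0 < m ∧
      Function.Injective
        (FreeGroup.lift (fun i : Bool => if i then U ^ m else V ^ m) :
          FreeGroup Bool →* ℍ[𝓞 K]ˣ) := by
  obtain ⟨hU₀, hU₁, hU₂, hU₃⟩ : U.val.re = a * rd ∧ U.val.imI = p ∧ U.val.imJ = 0 ∧
      U.val.imK = 0 := by rw [hU]; exact ⟨rfl, rfl, rfl, rfl⟩
  obtain ⟨hV₀, hV₁, hV₂, hV₃⟩ : V.val.re = b * rd ∧ V.val.imI = 0 ∧ V.val.imJ = q ∧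
      V.val.imK = 0 := by rw [hV]; exact ⟨rfl, rfl, rfl, rfl⟩
  have hd1 : 1 < d := by lia
  have hp : p ≠ 0 := ne_zero_of_isUnit_mul_sq_add_sq (a := a) hd1 hrd <| by
    simpa [Quaternion.normSq_def', hU₀, hU₁, hU₂, hU₃] using Quaternion.isUnit_normSq U
  have hq : q ≠ 0 := ne_zero_of_isUnit_mul_sq_add_sq (a := b) hd1 hrd <| by
    simpa [Quaternion.normSq_def', hV₀, hV₁, hV₂, hV₃] using Quaternion.isUnit_normSq V
  obtain ⟨σ⟩ : Nonempty (K →+* ℂ) := inferInstance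
  let τ : 𝓞 K →+* ℂ := σ.comp (algebraMap (𝓞 K) K)
  have hr : τ rd ^ 2 = -d := by rw [← map_pow, hrd]; simp
  let x : ℍ[𝓞 K]ˣ → ℂ := fun g => τ g.val.re + Complex.I * τ g.val.imI
  let y : ℍ[𝓞 K]ˣ → ℂ := fun g => Complex.I * τ g.val.imJ + τ g.val.imK
  have hI := Complex.I_mul_I
  have hUx : ∀ g, x (U * g) = (a * τ rd + p * Complex.I) * x g := fun g => by
    simp only [x, Units.val_mul, Quaternion.re_mul, Quaternion.imI_mul, hU₀, hU₁, hU₂, hU₃,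
      map_add, map_sub, map_mul, map_intCast, map_zero]
    linear_combination -(p : ℂ) * τ g.val.imI * hI
  have hUy : ∀ g, y (U * g) = (a * τ rd - p * Complex.I) * y g := fun g => by
    simp only [y, Units.val_mul, Quaternion.imJ_mul, Quaternion.imK_mul, hU₀, hU₁, hU₂, hU₃,
      map_add, map_sub, map_mul, map_intCast, map_zero]
    linear_combination (p : ℂ) * τ g.val.imJ * hI
  have hVxy : ∀ g, x (V * g) + y (V * g) = (b * τ rd + q * Complex.I) * (x g + y g) := fun g => by
    simp only [x, y, Units.val_mul, Quaternion.re_mul, Quaternion.imI_mul, Quaternion.imJ_mul,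
      Quaternion.imK_mul, hV₀, hV₁, hV₂, hV₃, map_add, map_sub, map_mul, map_intCast, map_zero]
    linear_combination -(q : ℂ) * (τ g.val.imI + τ g.val.imJ) * hI
  have hVyx : ∀ g, x (V * g) - y (V * g) = (b * τ rd - q * Complex.I) * (x g - y g) := fun g => by
    simp only [x, y, Units.val_mul, Quaternion.re_mul, Quaternion.imI_mul, Quaternion.imJ_mul,
      Quaternion.imK_mul, hV₀, hV₁, hV₂, hV₃, map_add, map_sub, map_mul, map_intCast, map_zero]
    linear_combination (q : ℂ) * (τ g.val.imI - τ g.val.imJ) * hI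
  have hxy : ∀ g, 0 < ‖x g‖ + ‖y g‖ := by
    intro g
    by_contra! h
    have hx0 : x g = 0 := norm_eq_zero.1 (by linarith [norm_nonneg (x g), norm_nonneg (y g)])
    have hy0 : y g = 0 := norm_eq_zero.1 (by linarith [norm_nonneg (x g), norm_nonneg (y g)])
    refine ((Quaternion.isUnit_normSq g).map τ).ne_zero ?_
    simp only [Quaternion.normSq_def', map_add, map_pow]
    linear_combination (τ g.val.re - Complex.I * τ g.val.imI) * hx0 +
      (τ g.val.imK - Complex.I * τ g.val.imJ) * hy0 +
      (τ g.val.imI ^ 2 + τ g.val.imJ ^ 2) * hI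
  have htwo : ∀ s t : ℂ, 2 * ‖s‖ ≤ ‖s + t‖ + ‖s - t‖ := fun s t => by
    simpa [← two_mul] using norm_add_le (s + t) (s - t)
  exact FreeGroup.exists_pow_injective_lift_of_ne
    (x := fun g => ‖x g‖) (y := fun g => ‖y g‖)
    (z := fun g => ‖x g + y g‖) (w := fun g => ‖x g - y g‖)
    (fun _ => norm_nonneg _) (fun _ => norm_nonneg _) (fun _ => norm_nonneg _)
    (fun _ => norm_nonneg _) hxy (fun _ => norm_add_le _ _) (fun _ => norm_sub_le _ _)
    (fun _ => htwo _ _) (fun g => by simpa [add_comm, norm_sub_rev] using htwo (y g) (x g))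
    (fun g => by simp only [hUx, norm_mul]) (fun g => by simp only [hUy, norm_mul])
    (fun g => by simp only [hVxy, norm_mul]) (fun g => by simp only [hVyx, norm_mul])
    (norm_nonneg _) (norm_nonneg _) (norm_nonneg _) (norm_nonneg _)
    (norm_mul_add_mul_I_ne_norm_mul_sub_mul_I hd hr ha hp)
    (norm_mul_add_mul_I_ne_norm_mul_sub_mul_I hd hr hb hq)
end
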